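/- Precise moderate deviations at the edge of the normality zone: for every x > 0, setting t_n := σ_n²/L_n², one has, as n → ∞, P((f_0(T_n) − μ_n)/σ_n ≥ √(t_n)·x) = (e^{−t_n x²/2}/(x·√(2π t_n)))·e^{x³/6}·(1 + o(1)) and P((f_0(T_n) − μ_n)/σ_n ≤ −√(t_n)·x) = (e^{−t_n x²/2}/(x·√(2π t_n)))·e^{−x³/6}·(1 + o(1)), where P((f_0(T_n) − μ_n)/σ_n ≥ s) := Σ_{k : k ≥ μ_n + s·σ_n} p_k^(n) and P((f_0(T_n) − μ_n)/σ_n ≤ s) := Σ_{k : k ≤ μ_n + s·σ_n} p_k^(n). -/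

import Mathlib

open Finset

/-- `p n k` is the probability `p_k^{(n)} = P(f_0(T_n) = k)` that the random convex chain
`T_n` has exactly `k` vertices (besides the two corners), given by Buchta's formula:
`p_k^{(n)} = 2^k · Σ_{i_1+⋯+i_k = n, i_j ≥ 1} Π_{j=1}^{k} i_j / (s_j (s_j + 1))`,
where `s_j = i_1 + ⋯ + i_j`.  In particular `p 0 0 = 1` and `p n 0 = 0` for `n ≥ 1`,
and `p n k = 0` for `k > n`. -/
noncomputable def p (n k : ℕ) : ℝ :=
  2 ^ k *
    ∑ i ∈ (Fintype.piFinset fun _ : Fin k => Finset.Icc 1 n).filter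
        (fun i => ∑ j, i j = n),
      ∏ j : Fin k,
        (i j : ℝ) /
          (((∑ l ∈ Finset.univ.filter (fun l => l ≤ j), i l : ℕ) : ℝ) *
            (((∑ l ∈ Finset.univ.filter (fun l => l ≤ j), i l : ℕ) : ℝ) + 1))

/-- The mean `μ_n = E f_0(T_n) = Σ_{k=1}^n k p_k^{(n)}`. -/
noncomputable def μ (n : ℕ) : ℝ := ∑ k ∈ Finset.Icc 1 n, (k : ℝ) * p n k

/-- The variance `σ_n² = Var f_0(T_n) = Σ_{k=1}^n (k − μ_n)² p_k^{(n)}`. -/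
noncomputable def σsq (n : ℕ) : ℝ := ∑ k ∈ Finset.Icc 1 n, ((k : ℝ) - μ n) ^ 2 * p n k

/-- `L_n`, the cube root of the third cumulant (= third central moment)
`κ_3(f_0(T_n)) = Σ_{k=1}^n (k − μ_n)³ p_k^{(n)}`. -/
noncomputable def L (n : ℕ) : ℝ :=
  (∑ k ∈ Finset.Icc 1 n, ((k : ℝ) - μ n) ^ 3 * p n k) ^ ((1 : ℝ) / 3)

/-- The upper-tail probability `P((f_0(T_n) − μ_n)/σ_n ≥ t) = Σ_{k ≥ μ_n + t σ_n} p_k^{(n)}`. -/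
noncomputable def tailProb (n : ℕ) (t : ℝ) : ℝ :=
  ∑ k ∈ (Finset.Icc 1 n).filter (fun k : ℕ => μ n + t * Real.sqrt (σsq n) ≤ (k : ℝ)), p n k

/-- The lower-tail probability `P((f_0(T_n) − μ_n)/σ_n ≤ s) = Σ_{k ≤ μ_n + s σ_n} p_k^{(n)}`. -/
noncomputable def lowerTailProb (n : ℕ) (s : ℝ) : ℝ :=
  ∑ k ∈ (Finset.Icc 1 n).filter (fun k : ℕ => (k : ℝ) ≤ μ n + s * Real.sqrt (σsq n)), p n k

theorem p_zero_right (n : ℕ) : p n 0 = if n = 0 then 1 else 0 := by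
  rcases Nat.eq_zero_or_pos n with h | h
  · subst h; simp [p]
  · have : (0 : ℕ) ≠ n := h.ne
    simp [p, h.ne', this]

theorem partialSum_castSucc {k : ℕ} (i : Fin (k + 1) → ℕ) (j : Fin k) :
    ∑ l ∈ univ.filter (fun l => l ≤ j.castSucc), i l =
      ∑ l ∈ univ.filter (fun l => l ≤ j), Fin.init i l := by
  simp only [Finset.sum_filter, Fin.sum_univ_castSucc, Fin.castSucc_le_castSucc_iff, Fin.init]
  have : ¬ Fin.last k ≤ j.castSucc := not_le.mpr (Fin.castSucc_lt_last j)
  simp [this]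

theorem p_succ_right (n k : ℕ) :
    p n (k + 1) = 2 / ((n : ℝ) * (n + 1)) * ∑ i ∈ Icc 1 n, (i : ℝ) * p (n - i) k := by
  simp only [p, Finset.mul_sum]
  rw [Finset.sum_sigma']
  refine Finset.sum_bij' (fun i _ => ⟨i (Fin.last k), Fin.init i⟩)
    (fun y _ => Fin.snoc (α := fun _ => ℕ) y.2 y.1) ?_ ?_ ?_ ?_ ?_
  · intro i hi
    simp only [mem_filter, Fintype.mem_piFinset, mem_Icc, mem_sigma] at hi ⊢
    obtain ⟨hi, hs⟩ := hi
    rw [Fin.sum_univ_castSucc] at hs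
    have hsum : ∑ j : Fin k, Fin.init i j = n - i (Fin.last k) := by
      simp only [Fin.init]; omega
    refine ⟨hi _, fun j => ⟨(hi _).1, ?_⟩, hsum⟩
    rw [← hsum]
    exact Finset.single_le_sum (f := Fin.init i) (fun _ _ => Nat.zero_le _) (mem_univ j)
  · rintro ⟨a, i⟩ hi
    simp only [mem_filter, Fintype.mem_piFinset, mem_Icc, mem_sigma] at hi ⊢
    obtain ⟨ha, hi, hs⟩ := hi
    refine ⟨fun j => ?_, ?_⟩
    · refine Fin.lastCases ?_ (fun j => ?_) j
      · simpa using ha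
      · have := hi j
        simp only [Fin.snoc_castSucc]
        omega
    · rw [Fin.sum_univ_castSucc]
      simp only [Fin.snoc_castSucc, Fin.snoc_last]
      omega
  · intro i _
    exact Fin.snoc_init_self i
  · rintro ⟨a, i⟩ _
    simp
  · intro i hi
    simp only [mem_filter, Fintype.mem_piFinset, mem_Icc] at hi
    have hlast : univ.filter (fun l => l ≤ Fin.last k) = univ := by
      ext l; simp [Fin.le_last]
    rw [Fin.prod_univ_castSucc]
    simp only [partialSum_castSucc, hlast, hi.2]
    simp only [Fin.init]
    ring

theorem p_nonneg (n k : ℕ) : 0 ≤ p n k := by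
  unfold p
  positivity

theorem p_eq_zero_of_lt {n k : ℕ} (h : n < k) : p n k = 0 := by
  induction k generalizing n with
  | zero => omega
  | succ k ih =>
    rw [p_succ_right, Finset.sum_eq_zero, mul_zero]
    intro i hi
    rw [mem_Icc] at hi
    rw [ih (by omega), mul_zero]

theorem mul_p_succ_right (n k : ℕ) :
    (n : ℝ) * (n + 1) * p n (k + 1) = 2 * ∑ m ∈ range n, ((n : ℝ) - m) * p m k := by
  rcases Nat.eq_zero_or_pos n with rfl | hn
  · simp
  have hn' : (n : ℝ) ≠ 0 := by positivity
  have hn1 : (n : ℝ) + 1 ≠ 0 := by positivity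
  rw [p_succ_right]
  have : ∑ i ∈ Icc 1 n, (i : ℝ) * p (n - i) k = ∑ m ∈ range n, ((n : ℝ) - m) * p m k := by
    refine Finset.sum_bij' (fun i _ => n - i) (fun m _ => n - m) ?_ ?_ ?_ ?_ ?_
    · intro i hi; simp only [mem_Icc, mem_range] at *; omega
    · intro i hi; simp only [mem_Icc, mem_range] at *; omega
    · intro i hi; simp only [mem_Icc] at *; omega
    · intro i hi; simp only [mem_range] at *; omega
    · intro i hi
      simp only [mem_Icc] at hi
      push_cast [Nat.cast_sub hi.2]
      ring
  rw [this]
  field_simp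

theorem p_recurrence (n k : ℕ) :
    ((n : ℝ) + 2) * (n + 3) * p (n + 2) (k + 1) =
      2 * (n + 1) * (n + 2) * p (n + 1) (k + 1) + 2 * p (n + 1) k - n * (n + 1) * p n (k + 1) := by
  have h0 := mul_p_succ_right n k
  have h1 := mul_p_succ_right (n + 1) k
  have h2 := mul_p_succ_right (n + 2) k
  simp only [Finset.sum_range_succ, sub_mul, Finset.sum_sub_distrib, ← Finset.mul_sum] at h0 h1 h2
  push_cast at h0 h1 h2
  linear_combination h2 - 2 * h1 + h0

section GeneratingPolynomial

open Polynomial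

/-- The probability generating polynomial of the number of vertices of the chain `T_n`. -/
noncomputable def genPoly (n : ℕ) : ℝ[X] := ∑ k ∈ range (n + 1), C (p n k) * X ^ k

theorem coeff_genPoly (n k : ℕ) : (genPoly n).coeff k = p n k := by
  simp only [genPoly, finsetSum_coeff, coeff_C_mul_X_pow, Finset.sum_ite_eq, mem_range]
  split_ifs with h
  · rfl
  · exact (p_eq_zero_of_lt (by omega)).symm

theorem genPoly_zero : genPoly 0 = 1 := by
  simp [genPoly, p_zero_right]

theorem genPoly_one : genPoly 1 = X := by
  simp [genPoly, p_zero_right, p_succ_right, Finset.sum_range_succ]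
  norm_num

theorem genPoly_recurrence (n : ℕ) :
    C (((n : ℝ) + 2) * (n + 3)) * genPoly (n + 2) =
      (C (2 * ((n : ℝ) + 1) * (n + 2)) + C 2 * X) * genPoly (n + 1)
        - C ((n : ℝ) * (n + 1)) * genPoly n := by
  ext k
  cases k with
  | zero =>
    simp only [add_mul, coeff_sub, coeff_add, coeff_C_mul, coeff_genPoly, mul_assoc,
      coeff_X_mul_zero, p_zero_right]
    rcases Nat.eq_zero_or_pos n with rfl | h
    · simp
    · simp [h.ne']
  | succ k =>
    simp only [add_mul, coeff_sub, coeff_add, coeff_C_mul, coeff_genPoly, mul_assoc, coeff_X_mul]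
    linear_combination p_recurrence n k

theorem eval_one_genPoly (n : ℕ) : (genPoly n).eval 1 = 1 := by
  induction n using Nat.twoStepInduction with
  | zero => simp [genPoly_zero]
  | one => simp [genPoly_one]
  | more n h0 h1 =>
    have h := congrArg (eval 1) (genPoly_recurrence n)
    simp only [eval_mul, eval_sub, eval_add, eval_C, eval_X, h0, h1] at h
    have hn : ((n : ℝ) + 2) * (n + 3) ≠ 0 := by positivity
    apply mul_left_cancel₀ hn
    linear_combination h

/-- The partial sums `1 + 1 / 2 ^ s + ⋯ + 1 / n ^ s`. -/
noncomputable def harmonicSum (s n : ℕ) : ℝ := ∑ i ∈ range n, 1 / ((i : ℝ) + 1) ^ s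

theorem harmonicSum_succ (s n : ℕ) :
    harmonicSum s (n + 1) = harmonicSum s n + 1 / ((n : ℝ) + 1) ^ s :=
  Finset.sum_range_succ _ _

theorem eval_one_derivative_genPoly (n : ℕ) :
    (derivative (genPoly (n + 1))).eval 1 = 2 / 3 * harmonicSum 1 (n + 1) + 1 / 3 := by
  have hrec (n : ℕ) := congrArg (fun P => (derivative P).eval 1) (genPoly_recurrence n)
  simp only [derivative_mul, derivative_sub, derivative_add, derivative_C, derivative_X, eval_mul,
    eval_sub, eval_add, eval_C, eval_X, eval_one_genPoly, eval_zero, eval_one] at hrec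
  induction n using Nat.twoStepInduction with
  | zero => simp [genPoly_one, harmonicSum]; norm_num
  | one =>
    have h := hrec 0
    simp [genPoly_one] at h
    simp [harmonicSum, Finset.sum_range_succ]
    linarith
  | more n h0 h1 =>
    have h := hrec (n + 1)
    simp only [Nat.add_assoc, Nat.reduceAdd] at h h0 h1 ⊢
    have hn : ((n : ℝ) + 3) * (n + 4) ≠ 0 := by positivity
    apply mul_left_cancel₀ hn
    have h' : ((n : ℝ) + 3) * (n + 4) * (derivative (genPoly (n + 3))).eval 1 =
        2 + (2 * ((n : ℝ) + 2) * (n + 3) + 2) * (derivative (genPoly (n + 2))).eval 1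
          - ((n : ℝ) + 1) * (n + 2) * (derivative (genPoly (n + 1))).eval 1 := by
      push_cast at h
      linear_combination h
    rw [h', h1, h0, harmonicSum_succ 1 (n + 2), harmonicSum_succ 1 (n + 1)]
    push_cast
    field_simp
    ring

theorem eval_one_derivative_two_genPoly (n : ℕ) :
    (derivative (derivative (genPoly (n + 1)))).eval 1 =
      (10 / 27 * harmonicSum 1 (n + 1) + 4 / 9 * harmonicSum 2 (n + 1) - 28 / 27
        + 4 / (9 * ((n : ℝ) + 2))) - (2 / 3 * harmonicSum 1 (n + 1) + 1 / 3)
        + (2 / 3 * harmonicSum 1 (n + 1) + 1 / 3) ^ 2 := by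
  have hrec (n : ℕ) :=
    congrArg (fun P => (derivative (derivative P)).eval 1) (genPoly_recurrence n)
  simp only [derivative_mul, derivative_sub, derivative_add, derivative_C, derivative_X, eval_mul,
    eval_sub, eval_add, eval_C, eval_X, eval_one_genPoly, eval_zero, eval_one,
    derivative_zero, derivative_one] at hrec
  induction n using Nat.twoStepInduction with
  | zero => simp [genPoly_one, harmonicSum]; norm_num
  | one =>
    have h := hrec 0
    simp [genPoly_one] at h
    simp [harmonicSum, Finset.sum_range_succ]
    linarith
  | more n h0 h1 =>
    have h := hrec (n + 1)
    have hd := eval_one_derivative_genPoly (n + 1)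
    simp only [Nat.add_assoc, Nat.reduceAdd] at h h0 h1 hd ⊢
    have hn : ((n : ℝ) + 3) * (n + 4) ≠ 0 := by positivity
    apply mul_left_cancel₀ hn
    have h' : ((n : ℝ) + 3) * (n + 4) * (derivative (derivative (genPoly (n + 3)))).eval 1 =
        4 * (derivative (genPoly (n + 2))).eval 1
          + (2 * ((n : ℝ) + 2) * (n + 3) + 2) * (derivative (derivative (genPoly (n + 2)))).eval 1
          - ((n : ℝ) + 1) * (n + 2) * (derivative (derivative (genPoly (n + 1)))).eval 1 := by
      push_cast at h
      linear_combination h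
    rw [h', h1, h0, hd, harmonicSum_succ 1 (n + 2), harmonicSum_succ 1 (n + 1),
      harmonicSum_succ 2 (n + 2), harmonicSum_succ 2 (n + 1)]
    push_cast
    field_simp
    ring

end GeneratingPolynomial

section RealRootedness

open Polynomial

theorem aeval_genPoly_recurrence (n : ℕ) (z : ℂ) :
    ((n : ℂ) + 2) * (n + 3) * aeval z (genPoly (n + 2)) =
      (2 * (n + 1) * (n + 2) + 2 * z) * aeval z (genPoly (n + 1))
        - n * (n + 1) * aeval z (genPoly n) := by
  have h := congrArg (aeval z) (genPoly_recurrence n)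
  simpa using h

theorem im_mul_im_genPoly_pos {z : ℂ} (hz : z.im ≠ 0) (n : ℕ) :
    0 < z.im * (aeval z (genPoly (n + 1)) * (starRingEnd ℂ) (aeval z (genPoly n))).im := by
  induction n with
  | zero =>
    simp only [zero_add, genPoly_one, genPoly_zero, aeval_X, map_one, mul_one]
    exact mul_self_pos.mpr hz
  | succ n ih =>
    have h := aeval_genPoly_recurrence n z
    generalize aeval z (genPoly (n + 1 + 1)) = c at *
    generalize aeval z (genPoly (n + 1)) = b at *
    generalize aeval z (genPoly n) = a at *
    have hb : 0 < b.re ^ 2 + b.im ^ 2 := by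
      by_contra hb
      have h1 : b.re = 0 := by nlinarith [sq_nonneg b.re, sq_nonneg b.im]
      have h2 : b.im = 0 := by nlinarith [sq_nonneg b.re, sq_nonneg b.im]
      simp [h1, h2] at ih
    have hre := congrArg Complex.re h
    have him := congrArg Complex.im h
    simp only [Complex.mul_re, Complex.mul_im, Complex.sub_re, Complex.sub_im, Complex.add_re,
      Complex.add_im, Complex.natCast_re, Complex.natCast_im, Complex.re_ofNat, Complex.im_ofNat,
      Complex.one_re, Complex.one_im, Complex.conj_re, Complex.conj_im] at hre him ih ⊢
    have hn : 0 < ((n : ℝ) + 2) * (n + 3) := by positivity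
    have hn' : 0 ≤ (n : ℝ) * (n + 1) := by positivity
    have hz2 : 0 < z.im * z.im := mul_self_pos.mpr hz
    have key : ((n : ℝ) + 2) * (n + 3) * (z.im * (c.re * -b.im + c.im * b.re)) =
        2 * (z.im * z.im) * (b.re ^ 2 + b.im ^ 2)
          + n * (n + 1) * (z.im * (b.re * -a.im + b.im * a.re)) := by
      linear_combination z.im * b.re * him - z.im * b.im * hre
    have h1 := mul_pos hz2 hb
    have h2 := mul_nonneg hn' ih.le
    exact pos_of_mul_pos_right (by rw [key]; linarith) hn.le

theorem aeval_genPoly_ne_zero {z : ℂ} (hz : z.im ≠ 0) (n : ℕ) : aeval z (genPoly n) ≠ 0 := by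
  intro h
  simpa [h] using im_mul_im_genPoly_pos hz n

theorem eval_genPoly_pos {x : ℝ} (hx : 0 < x) (n : ℕ) : 0 < (genPoly n).eval x := by
  have h1 := eval_one_genPoly n
  simp only [genPoly, eval_finsetSum, eval_mul, eval_C, eval_pow, eval_X, one_pow, mul_one]
    at h1 ⊢
  obtain ⟨k, hk, hpk⟩ : ∃ k ∈ range (n + 1), 0 < p n k := by
    by_contra! h
    linarith [Finset.sum_nonpos h]
  exact Finset.sum_pos' (fun k _ => mul_nonneg (p_nonneg n k) (by positivity))
    ⟨k, hk, by positivity⟩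

/-- The generating polynomial is that of a sum of independent Bernoulli variables. -/
theorem exists_bernoulli_factorization (n : ℕ) :
    ∃ (m : ℕ) (q : Fin m → ℝ), (∀ j, 0 ≤ q j ∧ q j ≤ 1) ∧
      genPoly n = ∏ j, (C (1 - q j) + C (q j) * X) := by
  set Q : ℂ[X] := (genPoly n).map (algebraMap ℝ ℂ) with hQ
  have hQ1 : Q.eval 1 = 1 := by
    have := eval_map_algebraMap (genPoly n) (1 : ℂ)
    rw [hQ, this, ← map_one (algebraMap ℝ ℂ), aeval_algebraMap_apply, coe_aeval_eq_eval,
      eval_one_genPoly]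
  have hQ0 : Q ≠ 0 := by
    intro h; simp [h] at hQ1
  have hroot : ∀ a ∈ Q.roots, a.im = 0 ∧ a.re ≤ 0 := by
    intro a ha
    have ha' : aeval a (genPoly n) = 0 := by
      have := (mem_roots hQ0).mp ha
      rwa [IsRoot.def, hQ, eval_map_algebraMap] at this
    have him : a.im = 0 := by
      by_contra h
      exact aeval_genPoly_ne_zero h n ha'
    refine ⟨him, ?_⟩
    by_contra! hre
    have hare : a = algebraMap ℝ ℂ a.re := by
      apply Complex.ext <;> simp [him]
    rw [hare, aeval_algebraMap_apply, coe_aeval_eq_eval] at ha'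
    have := eval_genPoly_pos hre n
    simp at ha'
    linarith
  have hfac := (IsAlgClosed.splits Q).eq_prod_roots
  obtain ⟨l, hl⟩ := Quot.exists_rep Q.roots
  change (l : Multiset ℂ) = _ at hl
  rw [← hl] at hroot hfac
  rw [Multiset.map_coe, Multiset.prod_coe] at hfac
  have hre : ∀ j : Fin l.length, 0 < 1 - (l[j.1]).re := fun j => by
    have := (hroot l[j.1] (by simp)).2
    linarith
  refine ⟨l.length, fun j => 1 / (1 - (l[j.1]).re), fun j => ?_, ?_⟩
  · have := (hroot l[j.1] (by simp)).2
    refine ⟨(one_div_pos.mpr (hre j)).le, ?_⟩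
    rw [div_le_one (hre j)]
    linarith
  · apply map_injective (algebraMap ℝ ℂ) (algebraMap ℝ ℂ).injective
    have hlin : ∀ j : Fin l.length, X - C (l[j.1]) = C ((1 - (l[j.1]).re : ℝ) : ℂ) *
        (C ((1 - 1 / (1 - (l[j.1]).re) : ℝ) : ℂ) + C ((1 / (1 - (l[j.1]).re) : ℝ) : ℂ) * X) := by
      intro j
      have h0 := hre j
      have ha : l[j.1] = (((l[j.1]).re : ℝ) : ℂ) := by
        apply Complex.ext <;> simp [(hroot l[j.1] (by simp)).1]
      rw [mul_add, ← mul_assoc, ← C_mul, ← C_mul, ← Complex.ofReal_mul, ← Complex.ofReal_mul,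
        mul_one_div_cancel h0.ne', mul_sub, mul_one_div_cancel h0.ne', mul_one, sub_sub_cancel_left]
      conv_lhs => rw [ha]
      simp
      ring
    rw [← Fin.prod_univ_fun_getElem l (fun a => X - C a), Finset.prod_congr rfl fun j _ => hlin j,
      Finset.prod_mul_distrib, ← mul_assoc, ← map_prod, ← C_mul] at hfac
    set c : ℂ := Q.leadingCoeff * ∏ j : Fin l.length, ((1 - (l[j.1]).re : ℝ) : ℂ) with hc
    have hc1 : c = 1 := by
      rw [hfac] at hQ1
      simpa [eval_prod] using hQ1
    rw [hc1, C_1, one_mul] at hfac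
    rw [← hQ, hfac, Polynomial.map_prod]
    simp

end RealRootedness

section Cumulants

open Polynomial

theorem sum_Icc_mul_p {n : ℕ} (hn : n ≠ 0) (f : ℕ → ℝ) :
    ∑ k ∈ Icc 1 n, f k * p n k = ∑ k ∈ range (n + 1), f k * p n k := by
  refine Finset.sum_subset (fun k hk => ?_) fun k hk hk' => ?_
  · simp only [mem_Icc, mem_range] at *; omega
  · have : k = 0 := by simp only [mem_Icc, mem_range] at *; omega
    simp [this, p_zero_right, hn]

theorem sum_range_p (n : ℕ) : ∑ k ∈ range (n + 1), p n k = 1 := by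
  have h := eval_one_genPoly n
  simpa [genPoly, eval_finsetSum] using h

theorem eval_one_derivative_genPoly_eq_sum (n : ℕ) :
    (derivative (genPoly n)).eval 1 = ∑ k ∈ range (n + 1), (k : ℝ) * p n k := by
  simp only [genPoly, derivative_sum, derivative_C_mul_X_pow, eval_finsetSum, eval_mul, eval_C,
    eval_pow, eval_X, one_pow, mul_one]
  exact Finset.sum_congr rfl fun k _ => mul_comm _ _

theorem eval_one_derivative_two_genPoly_eq_sum (n : ℕ) :
    (derivative (derivative (genPoly n))).eval 1 =
      ∑ k ∈ range (n + 1), ((k : ℝ) * (k - 1)) * p n k := by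
  simp only [genPoly, derivative_sum, derivative_C_mul_X_pow, eval_finsetSum, eval_mul, eval_C,
    eval_pow, eval_X, one_pow, mul_one]
  refine Finset.sum_congr rfl fun k _ => ?_
  rcases k with _ | k
  · simp
  · simp only [Nat.add_sub_cancel]; push_cast; ring

theorem eval_one_derivative_three_genPoly_eq_sum (n : ℕ) :
    (derivative (derivative (derivative (genPoly n)))).eval 1 =
      ∑ k ∈ range (n + 1), ((k : ℝ) * (k - 1) * (k - 2)) * p n k := by
  simp only [genPoly, derivative_sum, derivative_C_mul_X_pow, eval_finsetSum, eval_mul, eval_C,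
    eval_pow, eval_X, one_pow, mul_one]
  refine Finset.sum_congr rfl fun k _ => ?_
  rcases k with _ | _ | k
  · simp
  · simp
  · have h1 : k + 1 + 1 - 1 = k + 1 := rfl
    have h2 : k + 1 - 1 = k := rfl
    rw [h1, h2]
    push_cast
    ring

theorem μ_eq_eval {n : ℕ} (hn : n ≠ 0) : μ n = (derivative (genPoly n)).eval 1 := by
  rw [μ, sum_Icc_mul_p hn, eval_one_derivative_genPoly_eq_sum]

theorem σsq_eq_eval {n : ℕ} (hn : n ≠ 0) :
    σsq n = (derivative (derivative (genPoly n))).eval 1 + (derivative (genPoly n)).eval 1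
      - (derivative (genPoly n)).eval 1 ^ 2 := by
  have h0 := sum_range_p n
  have h1 := eval_one_derivative_genPoly_eq_sum n
  rw [σsq, sum_Icc_mul_p hn (fun k => ((k : ℝ) - μ n) ^ 2), μ_eq_eval hn]
  generalize (derivative (genPoly n)).eval 1 = m at *
  rw [eval_one_derivative_two_genPoly_eq_sum]
  have : ∑ k ∈ range (n + 1), ((k : ℝ) - m) ^ 2 * p n k =
      ∑ k ∈ range (n + 1), ((k : ℝ) * (k - 1)) * p n k
        + (1 - 2 * m) * ∑ k ∈ range (n + 1), (k : ℝ) * p n k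
        + m ^ 2 * ∑ k ∈ range (n + 1), p n k := by
    simp only [Finset.mul_sum, ← Finset.sum_add_distrib]
    exact Finset.sum_congr rfl fun k _ => by ring
  rw [this, h0, ← h1]
  ring

theorem third_central_moment_eq_eval {n : ℕ} (hn : n ≠ 0) :
    ∑ k ∈ Icc 1 n, ((k : ℝ) - μ n) ^ 3 * p n k =
      (derivative (derivative (derivative (genPoly n)))).eval 1
        + 3 * (derivative (derivative (genPoly n))).eval 1 + (derivative (genPoly n)).eval 1
        - 3 * (derivative (genPoly n)).eval 1 *
          ((derivative (derivative (genPoly n))).eval 1 + (derivative (genPoly n)).eval 1)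
        + 2 * (derivative (genPoly n)).eval 1 ^ 3 := by
  have h0 := sum_range_p n
  have h1 := eval_one_derivative_genPoly_eq_sum n
  have h2 := eval_one_derivative_two_genPoly_eq_sum n
  rw [sum_Icc_mul_p hn (fun k => ((k : ℝ) - μ n) ^ 3), μ_eq_eval hn]
  generalize (derivative (genPoly n)).eval 1 = m at *
  generalize (derivative (derivative (genPoly n))).eval 1 = m2 at *
  rw [eval_one_derivative_three_genPoly_eq_sum]
  have : ∑ k ∈ range (n + 1), ((k : ℝ) - m) ^ 3 * p n k =
      ∑ k ∈ range (n + 1), ((k : ℝ) * (k - 1) * (k - 2)) * p n k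
        + (3 - 3 * m) * ∑ k ∈ range (n + 1), ((k : ℝ) * (k - 1)) * p n k
        + (1 - 3 * m + 3 * m ^ 2) * ∑ k ∈ range (n + 1), (k : ℝ) * p n k
        - m ^ 3 * ∑ k ∈ range (n + 1), p n k := by
    simp only [Finset.mul_sum, ← Finset.sum_add_distrib, ← Finset.sum_sub_distrib]
    exact Finset.sum_congr rfl fun k _ => by ring
  rw [this, h0, ← h1, ← h2]
  ring

theorem bernoulli_prod_cumulants {ι : Type*} (q : ι → ℝ) (s : Finset ι) :
    (∏ j ∈ s, (C (1 - q j) + C (q j) * X)).eval 1 = 1 ∧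
    (derivative (∏ j ∈ s, (C (1 - q j) + C (q j) * X))).eval 1 = ∑ j ∈ s, q j ∧
    (derivative (derivative (∏ j ∈ s, (C (1 - q j) + C (q j) * X)))).eval 1 =
      ∑ j ∈ s, q j * (1 - q j) - ∑ j ∈ s, q j + (∑ j ∈ s, q j) ^ 2 ∧
    (derivative (derivative (derivative (∏ j ∈ s, (C (1 - q j) + C (q j) * X))))).eval 1 =
      ∑ j ∈ s, q j * (1 - q j) * (1 - 2 * q j)
        - 3 * (∑ j ∈ s, q j * (1 - q j) - ∑ j ∈ s, q j + (∑ j ∈ s, q j) ^ 2) - ∑ j ∈ s, q j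
        + 3 * (∑ j ∈ s, q j) * (∑ j ∈ s, q j * (1 - q j) + (∑ j ∈ s, q j) ^ 2)
        - 2 * (∑ j ∈ s, q j) ^ 3 := by
  classical
  induction s using Finset.induction_on with
  | empty => simp
  | insert a s ha ih =>
    obtain ⟨h0, h1, h2, h3⟩ := ih
    simp only [Finset.prod_insert ha, Finset.sum_insert ha]
    generalize ∏ j ∈ s, (C (1 - q j) + C (q j) * X) = P at *
    simp only [derivative_mul, derivative_add, derivative_C, derivative_X, eval_mul, eval_add,
      eval_C, eval_X, eval_zero, eval_one, derivative_zero, derivative_one, h0, h1, h2, h3]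
    refine ⟨by ring, by ring, by ring, by ring⟩

/-- A Bernoulli representation `q` of the distribution `p n`, together with the resulting
expressions for the first three cumulants. -/
theorem exists_bernoulli_representation {n : ℕ} (hn : n ≠ 0) :
    ∃ (m : ℕ) (q : Fin m → ℝ), (∀ j, 0 ≤ q j ∧ q j ≤ 1) ∧
      (∀ z : ℂ, ∑ k ∈ range (n + 1), (p n k : ℂ) * z ^ k = ∏ j, (1 - (q j : ℂ) + q j * z)) ∧
      μ n = ∑ j, q j ∧ σsq n = ∑ j, q j * (1 - q j) ∧
      ∑ k ∈ Icc 1 n, ((k : ℝ) - μ n) ^ 3 * p n k = ∑ j, q j * (1 - q j) * (1 - 2 * q j) := by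
  obtain ⟨m, q, hq, hP⟩ := exists_bernoulli_factorization n
  obtain ⟨-, h1, h2, h3⟩ := bernoulli_prod_cumulants q univ
  rw [← hP] at h1 h2 h3
  refine ⟨m, q, hq, fun z => ?_, ?_, ?_, ?_⟩
  · have h := congrArg (aeval z) hP
    rw [genPoly] at h
    simpa [map_sum, map_prod] using h
  · rw [μ_eq_eval hn, h1]
  · rw [σsq_eq_eval hn, h1, h2]; ring
  · rw [third_central_moment_eq_eval hn, h1, h2, h3]; ring

theorem harmonicSum_one_ge_log (n : ℕ) : Real.log (n + 1) ≤ harmonicSum 1 n := by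
  have h := log_add_one_le_harmonic n
  simpa [harmonicSum, harmonic] using h

theorem harmonicSum_nonneg (s n : ℕ) : 0 ≤ harmonicSum s n :=
  Finset.sum_nonneg fun i _ => by positivity

theorem μ_eq_harmonicSum {n : ℕ} (hn : n ≠ 0) : μ n = 2 / 3 * harmonicSum 1 n + 1 / 3 := by
  obtain ⟨n, rfl⟩ := Nat.exists_eq_succ_of_ne_zero hn
  rw [μ_eq_eval hn, eval_one_derivative_genPoly]

theorem σsq_eq_harmonicSum {n : ℕ} (hn : n ≠ 0) :
    σsq n = 10 / 27 * harmonicSum 1 n + 4 / 9 * harmonicSum 2 n - 28 / 27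
        + 4 / (9 * ((n : ℝ) + 1)) := by
  obtain ⟨n, rfl⟩ := Nat.exists_eq_succ_of_ne_zero hn
  rw [σsq_eq_eval hn, eval_one_derivative_two_genPoly, eval_one_derivative_genPoly]
  push_cast
  ring

theorem tendsto_harmonicSum_one : Filter.Tendsto (harmonicSum 1) Filter.atTop Filter.atTop := by
  refine Filter.tendsto_atTop_mono harmonicSum_one_ge_log ?_
  refine Real.tendsto_log_atTop.comp ?_
  exact Filter.tendsto_atTop_add_const_right _ _ tendsto_natCast_atTop_atTop

theorem tendsto_σsq : Filter.Tendsto σsq Filter.atTop Filter.atTop := by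
  have h : Filter.Tendsto (fun n => 10 / 27 * harmonicSum 1 n - 28 / 27) Filter.atTop
      Filter.atTop :=
    Filter.tendsto_atTop_add_const_right _ _
      (tendsto_harmonicSum_one.const_mul_atTop (by norm_num : (0 : ℝ) < 10 / 27))
  refine Filter.tendsto_atTop_mono' _ ?_ h
  filter_upwards [Filter.eventually_ne_atTop 0] with n hn
  have h1 := harmonicSum_nonneg 2 n
  have h2 : 0 ≤ 4 / (9 * ((n : ℝ) + 1)) := by positivity
  rw [σsq_eq_harmonicSum hn]
  linarith

/-- The third cumulant is of the same order as the variance; the lower bound comes from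
`(∑ q_j²)² ≤ (∑ q_j) (∑ q_j³)`. -/
theorem eventually_third_central_moment_bounds :
    ∀ᶠ n in Filter.atTop,
      σsq n / 18 ≤ ∑ k ∈ Icc 1 n, ((k : ℝ) - μ n) ^ 3 * p n k ∧
        ∑ k ∈ Icc 1 n, ((k : ℝ) - μ n) ^ 3 * p n k ≤ σsq n := by
  filter_upwards [Filter.eventually_ne_atTop 0,
    tendsto_harmonicSum_one.eventually_ge_atTop 100] with n hn hH
  obtain ⟨m, q, hq, -, h1, h2, h3⟩ := exists_bernoulli_representation hn
  have hnn : ∀ j, 0 ≤ q j * (1 - q j) := fun j =>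
    mul_nonneg (hq j).1 (by linarith [(hq j).2])
  rw [h3]
  constructor
  · have hcs := Finset.sum_sq_le_sum_mul_sum_of_sq_le_mul univ (r := fun j => q j ^ 2)
      (f := q) (g := fun j => q j ^ 3) (fun j _ => (hq j).1)
      (fun j _ => pow_nonneg (hq j).1 3) (fun j _ => le_of_eq (by ring))
    have hμ := μ_eq_harmonicSum hn
    have hσ := σsq_eq_harmonicSum hn
    have hz := harmonicSum_nonneg 2 n
    have h4 : 0 ≤ 4 / (9 * ((n : ℝ) + 1)) := by positivity
    set S1 := ∑ j, q j
    set S2 := ∑ j, q j ^ 2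
    set S3 := ∑ j, q j ^ 3
    have e2 : σsq n = S1 - S2 := by
      rw [h2, ← Finset.sum_sub_distrib]
      exact Finset.sum_congr rfl fun j _ => by ring
    have e3 : ∑ j, q j * (1 - q j) * (1 - 2 * q j) = S1 - 3 * S2 + 2 * S3 := by
      simp only [S1, S2, S3, Finset.mul_sum, ← Finset.sum_add_distrib, ← Finset.sum_sub_distrib]
      exact Finset.sum_congr rfl fun j _ => by ring
    have hS1 : 0 < S1 := by linarith
    have hV : 0 < S1 - S2 := by linarith
    have hkey : S1 / 18 ≤ S1 - 2 * S2 := by linarith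
    rw [e3, e2]
    have : S1 * ((S1 - S2) / 18) ≤ S1 * (S1 - 3 * S2 + 2 * S3) := by nlinarith
    exact le_of_mul_le_mul_left this hS1
  · rw [h2]
    refine Finset.sum_le_sum fun j _ => mul_le_of_le_one_right (hnn j) ?_
    linarith [(hq j).1]

end Cumulants

section CumulantGeneratingFunction

theorem norm_le_pow_succ_of_hasDerivAt {E : Type*} [NormedAddCommGroup E] [NormedSpace ℝ E]
    {h h' : ℝ → E} {C R : ℝ} {k : ℕ} (hC : 0 ≤ C) (h0 : h 0 = 0)
    (hd : ∀ t, HasDerivAt h (h' t) t) (hb : ∀ t, |t| ≤ R → ‖h' t‖ ≤ C * |t| ^ k) {s : ℝ}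
    (hs : |s| ≤ R) : ‖h s‖ ≤ C * |s| ^ (k + 1) := by
  have hmem (t : ℝ) : t ∈ Set.Icc (-|s|) |s| ↔ |t| ≤ |s| := abs_le.symm
  have := (convex_Icc (-|s|) |s|).norm_image_sub_le_of_norm_hasDerivWithin_le (f := h) (f' := h')
    (C := C * |s| ^ k) (x := 0) (y := s) (fun t _ => (hd t).hasDerivWithinAt)
    (fun t ht => (hb t (((hmem t).mp ht).trans hs)).trans (by
      have := (hmem t).mp ht
      gcongr)) ((hmem 0).mpr (by simp)) ((hmem s).mpr le_rfl)
  rw [h0, sub_zero, sub_zero, Real.norm_eq_abs] at this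
  rw [pow_succ, ← mul_assoc]
  exact this

/-- The success probability of a Bernoulli(`q`) variable after exponential tilting by `s`. -/
noncomputable def tilt (q s : ℝ) : ℝ := q * Real.exp s / (1 - q + q * Real.exp s)

variable {q s : ℝ}

theorem tilt_denom_pos (hq : 0 ≤ q ∧ q ≤ 1) (s : ℝ) : 0 < 1 - q + q * Real.exp s := by
  have := Real.exp_pos s
  rcases hq.1.eq_or_lt with h | h
  · simp [← h]
  · have := mul_pos h this
    linarith [hq.2]

theorem tilt_mem (hq : 0 ≤ q ∧ q ≤ 1) (s : ℝ) : 0 ≤ tilt q s ∧ tilt q s ≤ 1 := by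
  have hD := tilt_denom_pos hq s
  have := mul_nonneg hq.1 (Real.exp_pos s).le
  refine ⟨div_nonneg this hD.le, ?_⟩
  rw [tilt, div_le_one hD]
  linarith [hq.2]

theorem tilt_zero (q : ℝ) : tilt q 0 = q := by simp [tilt]

theorem hasDerivAt_tilt_denom (q s : ℝ) :
    HasDerivAt (fun s => 1 - q + q * Real.exp s) (q * Real.exp s) s :=
  ((Real.hasDerivAt_exp s).const_mul q).const_add (1 - q)

theorem hasDerivAt_log_tilt (hq : 0 ≤ q ∧ q ≤ 1) (s : ℝ) :
    HasDerivAt (fun s => Real.log (1 - q + q * Real.exp s)) (tilt q s) s :=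
  (hasDerivAt_tilt_denom q s).log (tilt_denom_pos hq s).ne'

theorem hasDerivAt_tilt (hq : 0 ≤ q ∧ q ≤ 1) (s : ℝ) :
    HasDerivAt (tilt q) (tilt q s * (1 - tilt q s)) s := by
  have hD := (tilt_denom_pos hq s).ne'
  have h := ((Real.hasDerivAt_exp s).const_mul q).div (hasDerivAt_tilt_denom q s) hD
  refine h.congr_deriv ?_
  rw [tilt]
  field_simp

theorem hasDerivAt_tilt_variance (hq : 0 ≤ q ∧ q ≤ 1) (s : ℝ) :
    HasDerivAt (fun s => tilt q s * (1 - tilt q s))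
      (tilt q s * (1 - tilt q s) * (1 - 2 * tilt q s)) s := by
  have h := hasDerivAt_tilt hq s
  exact (h.mul (h.const_sub 1)).congr_deriv (by ring)

theorem hasDerivAt_tilt_third (hq : 0 ≤ q ∧ q ≤ 1) (s : ℝ) :
    HasDerivAt (fun s => tilt q s * (1 - tilt q s) * (1 - 2 * tilt q s))
      (tilt q s * (1 - tilt q s) * (1 - 6 * (tilt q s * (1 - tilt q s)))) s := by
  have h := hasDerivAt_tilt hq s
  exact ((hasDerivAt_tilt_variance hq s).mul ((h.const_mul 2).const_sub 1)).congr_deriv (by ring)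

theorem tilt_variance_nonneg (hq : 0 ≤ q ∧ q ≤ 1) (s : ℝ) : 0 ≤ tilt q s * (1 - tilt q s) := by
  obtain ⟨h0, h1⟩ := tilt_mem hq s
  exact mul_nonneg h0 (by linarith)

theorem tilt_variance_le (hq : 0 ≤ q ∧ q ≤ 1) (hs : |s| ≤ 1) :
    tilt q s * (1 - tilt q s) ≤ 3 * (q * (1 - q)) := by
  have hD := tilt_denom_pos hq s
  have hv : 0 ≤ q * (1 - q) := mul_nonneg hq.1 (by linarith [hq.2])
  have heq : tilt q s * (1 - tilt q s) =
      q * (1 - q) * (Real.exp s / (1 - q + q * Real.exp s) ^ 2) := by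
    rw [tilt]
    field_simp
    ring
  have he : Real.exp |s| ≤ 3 :=
    (Real.exp_le_exp.mpr hs).trans (Real.exp_one_lt_d9.le.trans (by norm_num))
  rw [heq, mul_comm 3]
  refine mul_le_mul_of_nonneg_left (le_trans ?_ he) hv
  rw [div_le_iff₀ (by positivity)]
  rcases le_total 0 s with h | h
  · rw [abs_of_nonneg h]
    have h1 : 1 ≤ Real.exp s := Real.one_le_exp h
    have h2 : 1 ≤ 1 - q + q * Real.exp s := by nlinarith [hq.1]
    have h3 : 1 ≤ (1 - q + q * Real.exp s) ^ 2 := one_le_pow₀ h2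
    nlinarith [Real.exp_pos s]
  · rw [abs_of_nonpos h]
    have h1 : Real.exp s ≤ 1 := Real.exp_le_one_iff.mpr h
    have h2 : Real.exp s ≤ 1 - q + q * Real.exp s := by nlinarith [hq.2]
    have h3 : Real.exp s ^ 2 ≤ (1 - q + q * Real.exp s) ^ 2 :=
      pow_le_pow_left₀ (Real.exp_pos s).le h2 2
    have h4 : Real.exp (-s) * Real.exp s ^ 2 = Real.exp s := by
      rw [← Real.exp_nat_mul, ← Real.exp_add]; congr 1; push_cast; ring
    calc Real.exp s = Real.exp (-s) * Real.exp s ^ 2 := h4.symm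
      _ ≤ _ := mul_le_mul_of_nonneg_left h3 (Real.exp_pos _).le

theorem abs_tilt_variance_sub_le (hq : 0 ≤ q ∧ q ≤ 1) (hs : |s| ≤ 1) :
    |tilt q s * (1 - tilt q s) - q * (1 - q)| ≤ 3 * (q * (1 - q)) * |s| := by
  have hv : 0 ≤ 3 * (q * (1 - q)) := mul_nonneg (by norm_num) (mul_nonneg hq.1 (by linarith [hq.2]))
  have := norm_le_pow_succ_of_hasDerivAt (k := 0) (R := 1)
    (h := fun s => tilt q s * (1 - tilt q s) - q * (1 - q)) hv (by simp [tilt_zero])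
    (fun t => (hasDerivAt_tilt_variance hq t).sub_const _) (fun t ht => ?_) hs
  · simpa using this
  · rw [Real.norm_eq_abs, pow_zero, mul_one, abs_mul, abs_of_nonneg (tilt_variance_nonneg hq t)]
    refine (mul_le_of_le_one_right (tilt_variance_nonneg hq t) ?_).trans (tilt_variance_le hq ht)
    obtain ⟨h0, h1⟩ := tilt_mem hq t
    rw [abs_le]; constructor <;> linarith

theorem abs_tilt_sub_le (hq : 0 ≤ q ∧ q ≤ 1) (hs : |s| ≤ 1) :
    |tilt q s - q - q * (1 - q) * s| ≤ 3 * (q * (1 - q)) * |s| ^ 2 := by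
  have hv : 0 ≤ 3 * (q * (1 - q)) := mul_nonneg (by norm_num) (mul_nonneg hq.1 (by linarith [hq.2]))
  refine norm_le_pow_succ_of_hasDerivAt (k := 1) (R := 1)
    (h := fun s => tilt q s - q - q * (1 - q) * s)
    (h' := fun s => tilt q s * (1 - tilt q s) - q * (1 - q)) hv (by simp [tilt_zero])
    (fun t => ?_) (fun t ht => ?_) hs
  · exact (((hasDerivAt_tilt hq t).sub_const q).sub
      ((hasDerivAt_id t).const_mul (q * (1 - q)))).congr_deriv (by ring)
  · rw [pow_one]; exact abs_tilt_variance_sub_le hq ht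

theorem abs_log_tilt_sub_le (hq : 0 ≤ q ∧ q ≤ 1) (hs : |s| ≤ 1) :
    |Real.log (1 - q + q * Real.exp s) - q * s - q * (1 - q) * s ^ 2 / 2
      - q * (1 - q) * (1 - 2 * q) * s ^ 3 / 6| ≤ 3 * (q * (1 - q)) * |s| ^ 4 := by
  have hv : 0 ≤ 3 * (q * (1 - q)) := mul_nonneg (by norm_num) (mul_nonneg hq.1 (by linarith [hq.2]))
  set v := q * (1 - q) with hvdef
  set w := v * (1 - 2 * q) with hw
  have h3 : ∀ t, |t| ≤ 1 → ‖tilt q t * (1 - tilt q t) * (1 - 2 * tilt q t) - w‖ ≤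
      3 * v * |t| ^ (0 + 1) := fun t ht => by
    refine norm_le_pow_succ_of_hasDerivAt (k := 0) (R := 1)
      (h := fun s => tilt q s * (1 - tilt q s) * (1 - 2 * tilt q s) - w) hv
      (by simp [tilt_zero, hw, hvdef])
      (fun t => (hasDerivAt_tilt_third hq t).sub_const _) (fun t ht => ?_) ht
    rw [Real.norm_eq_abs, pow_zero, mul_one, abs_mul, abs_of_nonneg (tilt_variance_nonneg hq t)]
    refine (mul_le_of_le_one_right (tilt_variance_nonneg hq t) ?_).trans (tilt_variance_le hq ht)
    have h0 := tilt_variance_nonneg hq t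
    have h1 : tilt q t * (1 - tilt q t) ≤ 1 / 4 := by nlinarith [sq_nonneg (tilt q t - 1 / 2)]
    rw [abs_le]; constructor <;> linarith
  have h2 : ∀ t, |t| ≤ 1 → ‖tilt q t * (1 - tilt q t) - v - w * t‖ ≤ 3 * v * |t| ^ (1 + 1) :=
    fun t ht => by
    refine norm_le_pow_succ_of_hasDerivAt (k := 1) (R := 1)
      (h := fun s => tilt q s * (1 - tilt q s) - v - w * s) hv
      (by simp [tilt_zero, hvdef]) (fun t => ?_) h3 ht
    exact (((hasDerivAt_tilt_variance hq t).sub_const v).sub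
      ((hasDerivAt_id t).const_mul w)).congr_deriv (by ring)
  have h1 : ∀ t, |t| ≤ 1 → ‖tilt q t - q - v * t - w * t ^ 2 / 2‖ ≤ 3 * v * |t| ^ (2 + 1) :=
    fun t ht => by
    refine norm_le_pow_succ_of_hasDerivAt (k := 2) (R := 1)
      (h := fun s => tilt q s - q - v * s - w * s ^ 2 / 2) hv
      (by simp [tilt_zero]) (fun t => ?_) h2 ht
    exact ((((hasDerivAt_tilt hq t).sub_const q).sub ((hasDerivAt_id t).const_mul v)).sub
      (((hasDerivAt_pow 2 t).const_mul w).div_const 2)).congr_deriv (by push_cast; ring)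
  refine norm_le_pow_succ_of_hasDerivAt (k := 3) (R := 1)
    (h := fun s => Real.log (1 - q + q * Real.exp s) - q * s - v * s ^ 2 / 2 - w * s ^ 3 / 6) hv
    (by simp) (fun t => ?_) h1 hs
  exact ((((hasDerivAt_log_tilt hq t).sub ((hasDerivAt_id t).const_mul q)).sub
    (((hasDerivAt_pow 2 t).const_mul v).div_const 2)).sub
      (((hasDerivAt_pow 3 t).const_mul w).div_const 6)).congr_deriv (by push_cast; ring)

end CumulantGeneratingFunction

section CharacteristicFunction

open Complex

theorem norm_cexp_ofReal_mul_I_sub_taylor_le (y : ℝ) :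
    ‖cexp (y * I) - 1 - y * I + y ^ 2 / 2‖ ≤ |y| ^ 3 := by
  have h0 : ∀ t : ℝ, HasDerivAt (fun t : ℝ => cexp (t * I)) (cexp (t * I) * I) t := fun t => by
    have := ((ofRealCLM.hasDerivAt (x := t)).mul_const I).cexp
    simpa using this
  have hid : ∀ t : ℝ, HasDerivAt (fun t : ℝ => (t : ℂ)) 1 t := fun t => by
    exact (hasDerivAt_id t).ofReal_comp
  have h1 : ∀ t : ℝ, |t| ≤ |y| → ‖cexp (t * I) - 1‖ ≤ 1 * |t| ^ (0 + 1) := fun t ht =>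
    norm_le_pow_succ_of_hasDerivAt (R := |y|) zero_le_one (by simp) (fun t => (h0 t).sub_const 1)
      (fun t _ => by simp) ht
  have h2 : ∀ t : ℝ, |t| ≤ |y| → ‖cexp (t * I) - 1 - t * I‖ ≤ 1 * |t| ^ (1 + 1) := fun t ht =>
    norm_le_pow_succ_of_hasDerivAt (R := |y|) (h' := fun t : ℝ => (cexp (t * I) - 1) * I)
      zero_le_one (by simp)
      (fun t => (((h0 t).sub_const 1).sub ((hid t).mul_const I)).congr_deriv (by ring))
      (fun t ht => by simpa using h1 t ht) ht
  have h3 := norm_le_pow_succ_of_hasDerivAt (R := |y|)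
    (h := fun t : ℝ => cexp (t * I) - 1 - t * I + t ^ 2 / 2)
    (h' := fun t : ℝ => (cexp (t * I) - 1 - t * I) * I) zero_le_one (by simp)
    (fun t => ((((h0 t).sub_const 1).sub ((hid t).mul_const I)).add
      (((hid t).pow 2).div_const 2)).congr_deriv (by
        push_cast
        linear_combination (t : ℂ) * I_sq))
    (fun t ht => by rw [norm_mul, norm_I, mul_one]; exact h2 t ht) le_rfl
  simpa using h3

theorem abs_exp_neg_sub_le {x : ℝ} (hx : 0 ≤ x) : |Real.exp (-x) - 1 + x| ≤ x ^ 2 := by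
  have h1 := Real.add_one_le_exp (-x)
  have h2 : Real.exp (-x) ≤ 1 - x + x ^ 2 := by
    rw [Real.exp_neg]
    refine (inv_anti₀ (by linarith) (Real.add_one_le_exp x)).trans ?_
    rw [inv_le_iff_one_le_mul₀ (by linarith)]
    nlinarith [pow_nonneg hx 3]
  rw [abs_le]
  constructor <;> nlinarith [sq_nonneg x]

/-- The characteristic function of a centred Bernoulli(`q`) variable. -/
noncomputable def bernoulliCharFun (q θ : ℝ) : ℂ :=
  (1 - q + q * cexp (θ * I)) * cexp (-(q * θ : ℝ) * I)

variable {q θ : ℝ}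

theorem norm_bernoulliCharFun_le (hq : 0 ≤ q ∧ q ≤ 1) (hθ : |θ| ≤ Real.pi) :
    ‖bernoulliCharFun q θ‖ ≤ Real.exp (-(q * (1 - q)) * θ ^ 2 / 5) := by
  have hv : 0 ≤ q * (1 - q) := mul_nonneg hq.1 (by linarith [hq.2])
  have hn : ‖bernoulliCharFun q θ‖ = ‖(1 - q + q * cexp (θ * I) : ℂ)‖ := by
    rw [bernoulliCharFun, norm_mul, ← ofReal_neg, norm_exp_ofReal_mul_I, mul_one]
  have hsq : ‖(1 - q + q * cexp (θ * I) : ℂ)‖ ^ 2 = 1 - 2 * (q * (1 - q)) * (1 - Real.cos θ) := by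
    rw [← normSq_eq_norm_sq, normSq_apply]
    simp [exp_ofReal_mul_I_re, exp_ofReal_mul_I_im]
    linear_combination q ^ 2 * Real.sin_sq_add_cos_sq θ
  have hcos : θ ^ 2 / 5 ≤ 1 - Real.cos θ := by
    have h1 := Real.cos_le_one_sub_mul_cos_sq hθ
    have hpi : Real.pi ^ 2 < 10 := by nlinarith [Real.pi_lt_d2, Real.pi_gt_three]
    have h2 : 1 / 5 ≤ 2 / Real.pi ^ 2 := by
      rw [div_le_div_iff₀ (by norm_num) (by positivity)]; linarith
    nlinarith [mul_le_mul_of_nonneg_right h2 (sq_nonneg θ)]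
  rw [hn]
  refine (sq_le_sq₀ (norm_nonneg _) (Real.exp_pos _).le).mp ?_
  rw [hsq, ← Real.exp_nat_mul]
  refine le_trans ?_ (Real.add_one_le_exp _)
  push_cast
  nlinarith

theorem norm_bernoulliCharFun_sub_gaussian_le (hq : 0 ≤ q ∧ q ≤ 1) (hθ : |θ| ≤ Real.pi) :
    ‖bernoulliCharFun q θ - Real.exp (-(q * (1 - q)) * θ ^ 2 / 2)‖ ≤
      2 * (q * (1 - q)) * |θ| ^ 3 := by
  set v := q * (1 - q) with hvdef
  have hq' : 0 ≤ 1 - q := by linarith [hq.2]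
  have hv : 0 ≤ v := mul_nonneg hq.1 hq'
  have hv4 : v ≤ 1 / 4 := by nlinarith [sq_nonneg (q - 1 / 2)]
  have h1 := norm_cexp_ofReal_mul_I_sub_taylor_le (-(q * θ))
  have h2 := norm_cexp_ofReal_mul_I_sub_taylor_le ((1 - q) * θ)
  have h3 := abs_exp_neg_sub_le (x := v * θ ^ 2 / 2) (by positivity)
  rw [abs_neg, abs_mul, abs_of_nonneg hq.1] at h1
  rw [abs_mul, abs_of_nonneg hq'] at h2
  have hsplit : bernoulliCharFun q θ - Real.exp (-v * θ ^ 2 / 2) =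
      (1 - q : ℝ) * (cexp ((-(q * θ) : ℝ) * I) - 1 - (-(q * θ) : ℝ) * I
        + ((-(q * θ) : ℝ) : ℂ) ^ 2 / 2)
      + (q : ℝ) * (cexp (((1 - q) * θ : ℝ) * I) - 1 - ((1 - q) * θ : ℝ) * I
        + (((1 - q) * θ : ℝ) : ℂ) ^ 2 / 2)
      - ((Real.exp (-(v * θ ^ 2 / 2)) - 1 + v * θ ^ 2 / 2 : ℝ) : ℂ) := by
    have hexp : cexp (((1 - q) * θ : ℝ) * I) = cexp (θ * I) * cexp (-(q * θ : ℝ) * I) := by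
      rw [← Complex.exp_add]; congr 1; push_cast; ring
    have hr : -v * θ ^ 2 / 2 = -(v * θ ^ 2 / 2) := by ring
    rw [hexp, hr, bernoulliCharFun, hvdef]
    push_cast
    ring
  rw [hsplit]
  have hθ4 : |θ| ≤ 4 := hθ.trans Real.pi_lt_four.le
  have hx : (v * θ ^ 2 / 2) ^ 2 ≤ v * |θ| ^ 3 := by
    have : (v * θ ^ 2 / 2) ^ 2 = v * |θ| ^ 3 * (v * |θ| / 4) := by
      rw [← sq_abs θ]; ring
    rw [this]
    exact mul_le_of_le_one_right (by positivity) (by nlinarith [abs_nonneg θ])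
  calc _ ≤ (1 - q) * (q * |θ|) ^ 3 + q * ((1 - q) * |θ|) ^ 3 + (v * θ ^ 2 / 2) ^ 2 := by
        refine (norm_sub_le _ _).trans (add_le_add ((norm_add_le _ _).trans (add_le_add ?_ ?_)) ?_)
        · rw [norm_mul, norm_real, Real.norm_of_nonneg hq']
          exact mul_le_mul_of_nonneg_left h1 hq'
        · rw [norm_mul, norm_real, Real.norm_of_nonneg hq.1]
          exact mul_le_mul_of_nonneg_left h2 hq.1
        · rw [norm_real]; exact h3
    _ = v * |θ| ^ 3 * (1 - 2 * v) + (v * θ ^ 2 / 2) ^ 2 := by rw [hvdef]; ring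
    _ ≤ v * |θ| ^ 3 + v * |θ| ^ 3 :=
        add_le_add (mul_le_of_le_one_right (by positivity) (by linarith)) hx
    _ = _ := by ring

theorem bernoulliCharFun_prod_bounds {ι : Type*} {q : ι → ℝ} (hq : ∀ j, 0 ≤ q j ∧ q j ≤ 1)
    (s : Finset ι) (hθ : |θ| ≤ Real.pi) :
    ‖∏ j ∈ s, bernoulliCharFun (q j) θ‖ ≤
        Real.exp (-(∑ j ∈ s, q j * (1 - q j)) * θ ^ 2 / 5) ∧
      ‖∏ j ∈ s, bernoulliCharFun (q j) θ
          - Real.exp (-(∑ j ∈ s, q j * (1 - q j)) * θ ^ 2 / 2)‖ ≤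
        6 * (∑ j ∈ s, q j * (1 - q j)) * |θ| ^ 3 *
          Real.exp (-(∑ j ∈ s, q j * (1 - q j)) * θ ^ 2 / 5) := by
  classical
  induction s using Finset.induction_on with
  | empty => simp
  | insert a s ha ih =>
    obtain ⟨ih1, ih2⟩ := ih
    simp only [Finset.prod_insert ha, Finset.sum_insert ha]
    have hV : 0 ≤ ∑ j ∈ s, q j * (1 - q j) := Finset.sum_nonneg fun j _ =>
      mul_nonneg (hq j).1 (by linarith [(hq j).2])
    have hv : 0 ≤ q a * (1 - q a) := mul_nonneg (hq a).1 (by linarith [(hq a).2])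
    have hv4 : q a * (1 - q a) ≤ 1 / 4 := by nlinarith [sq_nonneg (q a - 1 / 2)]
    have b1 := norm_bernoulliCharFun_le (hq a) hθ
    have b2 := norm_bernoulliCharFun_sub_gaussian_le (hq a) hθ
    generalize ∏ j ∈ s, bernoulliCharFun (q j) θ = P at *
    generalize ∑ j ∈ s, q j * (1 - q j) = V at *
    generalize q a * (1 - q a) = v at *
    generalize bernoulliCharFun (q a) θ = f at *
    have e5 : Real.exp (-(v + V) * θ ^ 2 / 5) =
        Real.exp (-v * θ ^ 2 / 5) * Real.exp (-V * θ ^ 2 / 5) := by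
      rw [← Real.exp_add]; congr 1; ring
    have e2 : Real.exp (-(v + V) * θ ^ 2 / 2) =
        Real.exp (-v * θ ^ 2 / 2) * Real.exp (-V * θ ^ 2 / 2) := by
      rw [← Real.exp_add]; congr 1; ring
    have hle : Real.exp (-v * θ ^ 2 / 2) ≤ Real.exp (-v * θ ^ 2 / 5) :=
      Real.exp_le_exp.mpr (by nlinarith [mul_nonneg hv (sq_nonneg θ)])
    have hge : 1 ≤ 3 * Real.exp (-v * θ ^ 2 / 5) := by
      have hpi : Real.pi ^ 2 < 10 := by nlinarith [Real.pi_lt_d2, Real.pi_gt_three]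
      have hθ2 : θ ^ 2 ≤ Real.pi ^ 2 := sq_le_sq' (abs_le.mp hθ).1 (abs_le.mp hθ).2
      have : -(1 / 2) + 1 ≤ Real.exp (-v * θ ^ 2 / 5) :=
        (Real.add_one_le_exp _).trans (Real.exp_le_exp.mpr (by nlinarith [sq_nonneg θ]))
      linarith
    constructor
    · rw [norm_mul, e5]
      exact mul_le_mul b1 ih1 (norm_nonneg _) (Real.exp_pos _).le
    · have hsplit : f * P - (Real.exp (-(v + V) * θ ^ 2 / 2) : ℂ) =
          (f - (Real.exp (-v * θ ^ 2 / 2) : ℂ)) * P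
            + (Real.exp (-v * θ ^ 2 / 2) : ℂ) * (P - (Real.exp (-V * θ ^ 2 / 2) : ℂ)) := by
        rw [e2]; push_cast; ring
      rw [hsplit, e5]
      have t1 : ‖(f - (Real.exp (-v * θ ^ 2 / 2) : ℂ)) * P‖ ≤
          2 * v * |θ| ^ 3 * Real.exp (-V * θ ^ 2 / 5) := by
        rw [norm_mul]
        exact mul_le_mul b2 ih1 (norm_nonneg _) (by positivity)
      have t2 : ‖(Real.exp (-v * θ ^ 2 / 2) : ℂ) * (P - (Real.exp (-V * θ ^ 2 / 2) : ℂ))‖ ≤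
          Real.exp (-v * θ ^ 2 / 5) * (6 * V * |θ| ^ 3 * Real.exp (-V * θ ^ 2 / 5)) := by
        rw [norm_mul, norm_real, Real.norm_of_nonneg (Real.exp_pos _).le]
        exact mul_le_mul hle ih2 (norm_nonneg _) (Real.exp_pos _).le
      have t3 : 2 * v * |θ| ^ 3 * Real.exp (-V * θ ^ 2 / 5) ≤
          2 * v * |θ| ^ 3 * Real.exp (-V * θ ^ 2 / 5) * (3 * Real.exp (-v * θ ^ 2 / 5)) :=
        le_mul_of_one_le_right (by positivity) hge
      refine (norm_add_le _ _).trans ((add_le_add (t1.trans t3) t2).trans (le_of_eq ?_))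
      ring

end CharacteristicFunction

section LocalLimit

open Complex MeasureTheory

theorem integral_cexp_int_mul (l : ℤ) :
    ∫ θ in (-Real.pi)..Real.pi, cexp ((l : ℂ) * θ * I) =
      if l = 0 then 2 * (Real.pi : ℂ) else 0 := by
  split_ifs with h
  · simp [h]; ring
  · have hc : (l : ℂ) * I ≠ 0 := mul_ne_zero (by exact_mod_cast h) I_ne_zero
    have he : ∀ θ : ℝ, cexp ((l : ℂ) * θ * I) = cexp ((l : ℂ) * I * θ) := fun θ => by
      congr 1; ring
    simp only [he]
    rw [integral_exp_mul_complex hc, div_eq_zero_iff]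
    left
    rw [sub_eq_zero, Complex.exp_eq_exp_iff_exists_int]
    exact ⟨l, by push_cast; ring⟩

theorem two_pi_mul_coeff_eq_integral (S : Finset ℤ) (w : ℤ → ℝ) (hw : ∀ k ∉ S, w k = 0) (k : ℤ) :
    ∫ θ in (-Real.pi)..Real.pi, (∑ l ∈ S, (w l : ℂ) * cexp ((l : ℂ) * θ * I)) *
      cexp (-(k : ℂ) * θ * I) = 2 * Real.pi * w k := by
  have h1 : ∀ θ : ℝ, (∑ l ∈ S, (w l : ℂ) * cexp ((l : ℂ) * θ * I)) * cexp (-(k : ℂ) * θ * I) =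
      ∑ l ∈ S, (w l : ℂ) * cexp (((l - k : ℤ) : ℂ) * θ * I) := fun θ => by
    rw [Finset.sum_mul]
    refine Finset.sum_congr rfl fun l _ => ?_
    rw [mul_assoc, ← Complex.exp_add]
    congr 2
    push_cast; ring
  simp only [h1]
  rw [intervalIntegral.integral_finsetSum
    fun l _ => Continuous.intervalIntegrable (by fun_prop) _ _]
  simp only [intervalIntegral.integral_const_mul, integral_cexp_int_mul, sub_eq_zero, mul_ite,
    mul_zero, Finset.sum_ite_eq']
  split_ifs with h
  · ring
  · simp [hw k h]

theorem integrable_abs_mul_exp_neg_mul_sq {b : ℝ} (hb : 0 < b) :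
    Integrable fun θ : ℝ => |θ| * Real.exp (-b * θ ^ 2) := by
  refine (integrable_mul_exp_neg_mul_sq hb).norm.congr (.of_forall fun θ => ?_)
  simp

theorem integral_abs_mul_exp_neg_mul_sq {b : ℝ} (hb : 0 < b) :
    ∫ θ : ℝ, |θ| * Real.exp (-b * θ ^ 2) = 1 / b := by
  have h := integral_comp_abs (f := fun θ : ℝ => θ * Real.exp (-b * θ ^ 2))
  simp only [sq_abs] at h
  rw [h]
  have h2 := integral_mul_cexp_neg_mul_sq (b := (b : ℂ)) (by simpa using hb)
  have h3 : ∫ r : ℝ in Set.Ioi 0, r * Real.exp (-b * r ^ 2) = (2 * b)⁻¹ := by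
    have : ((∫ r : ℝ in Set.Ioi 0, r * Real.exp (-b * r ^ 2) : ℝ) : ℂ) = ((2 * b)⁻¹ : ℝ) := by
      rw [← integral_complex_ofReal]
      push_cast
      exact h2
    exact_mod_cast this
  rw [h3]
  field_simp

/-- A local limit theorem for sums of independent Bernoulli variables, with absolute constants. -/
theorem abs_coeff_sub_gaussian_le {ι : Type*} [Fintype ι] {q : ι → ℝ}
    (hq : ∀ j, 0 ≤ q j ∧ q j ≤ 1) {S : Finset ℤ} {w : ℤ → ℝ} (hw : ∀ k ∉ S, w k = 0)
    (hS : ∀ θ : ℝ, ∑ l ∈ S, (w l : ℂ) * cexp ((l : ℂ) * θ * I) =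
      ∏ j, (1 - (q j : ℂ) + q j * cexp (θ * I)))
    (hV : 0 < ∑ j, q j * (1 - q j)) (k : ℤ) :
    |w k - 1 / √(2 * Real.pi * ∑ j, q j * (1 - q j))| ≤
      100 * (1 + |k - ∑ j, q j|) / ∑ j, q j * (1 - q j) := by
  set V := ∑ j, q j * (1 - q j) with hVdef
  set y : ℝ := k - ∑ j, q j with hy
  set ψ : ℝ → ℂ := fun θ => (∏ j, bernoulliCharFun (q j) θ) * cexp ((-(y * θ) : ℝ) * I) with hψ
  have hψeq : ∀ θ : ℝ, (∑ l ∈ S, (w l : ℂ) * cexp ((l : ℂ) * θ * I)) * cexp (-(k : ℂ) * θ * I) =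
      ψ θ := fun θ => by
    simp only [hψ, bernoulliCharFun]
    rw [hS, Finset.prod_mul_distrib, mul_assoc (∏ j, _) _ (cexp _), ← Complex.exp_sum,
      ← Complex.exp_add]
    congr 2
    rw [← Finset.sum_mul, ← add_mul, Finset.sum_neg_distrib]
    congr 1
    rw [hy]
    push_cast
    rw [← Finset.sum_mul]
    ring
  have hψcont : Continuous ψ := by
    simp only [hψ, bernoulliCharFun]; fun_prop
  have hint := two_pi_mul_coeff_eq_integral S w hw k
  simp only [hψeq] at hint
  rw [intervalIntegral.integral_of_le (by linarith [Real.pi_pos]),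
    ← integral_indicator measurableSet_Ioc] at hint
  set g : ℝ → ℂ := fun θ => (Real.exp (-(V / 2) * θ ^ 2) : ℝ) with hg
  have hgint : Integrable g := (integrable_exp_neg_mul_sq (by positivity)).ofReal
  have hψint : Integrable ((Set.Ioc (-Real.pi) Real.pi).indicator ψ) :=
    (integrable_indicator_iff measurableSet_Ioc).mpr
      (hψcont.integrableOn_Icc.mono_set Set.Ioc_subset_Icc_self)
  have hgval : ∫ θ, g θ = (√(Real.pi / (V / 2)) : ℝ) := by
    rw [integral_complex_ofReal, integral_gaussian]
  have hbound : ∀ θ : ℝ, ‖(Set.Ioc (-Real.pi) Real.pi).indicator ψ θ - g θ‖ ≤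
      (60 + |y|) * (|θ| * Real.exp (-(V / 10) * θ ^ 2)) := fun θ => by
    have hle : Real.exp (-(V / 2) * θ ^ 2) ≤ Real.exp (-(V / 10) * θ ^ 2) :=
      Real.exp_le_exp.mpr (by nlinarith [mul_nonneg hV.le (sq_nonneg θ)])
    by_cases h : θ ∈ Set.Ioc (-Real.pi) Real.pi
    · rw [Set.indicator_of_mem h]
      have hθ : |θ| ≤ Real.pi := abs_le.mpr ⟨h.1.le, h.2⟩
      obtain ⟨-, h2⟩ := bernoulliCharFun_prod_bounds hq Finset.univ hθ
      rw [← hVdef] at h2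
      have hr : -V * θ ^ 2 / 2 = -(V / 2) * θ ^ 2 := by ring
      rw [hr] at h2
      have hsplit : ψ θ - g θ = (∏ j, bernoulliCharFun (q j) θ - g θ) *
          cexp ((-(y * θ) : ℝ) * I) + g θ * (cexp (I * (-(y * θ) : ℝ)) - 1) := by
        simp only [hψ]; rw [mul_comm I]; ring
      have t2 : ‖g θ * (cexp (I * (-(y * θ) : ℝ)) - 1)‖ ≤
          Real.exp (-(V / 10) * θ ^ 2) * (|y| * |θ|) := by
        rw [norm_mul]
        refine mul_le_mul ?_ ?_ (norm_nonneg _) (Real.exp_pos _).le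
        · rw [hg, norm_real, Real.norm_of_nonneg (Real.exp_pos _).le]; exact hle
        · refine (Real.norm_exp_I_mul_ofReal_sub_one_le).trans ?_
          rw [Real.norm_eq_abs, abs_neg, abs_mul]
      have t1 : 6 * V * |θ| ^ 3 * Real.exp (-V * θ ^ 2 / 5) ≤
          60 * (|θ| * Real.exp (-(V / 10) * θ ^ 2)) := by
        have e1 : Real.exp (-V * θ ^ 2 / 5) =
            Real.exp (-(V / 10 * θ ^ 2)) * Real.exp (-(V / 10) * θ ^ 2) := by
          rw [← Real.exp_add]; congr 1; ring
        have e2 : V / 10 * θ ^ 2 * Real.exp (-(V / 10 * θ ^ 2)) ≤ 1 := by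
          rw [Real.exp_neg, mul_inv_le_iff₀ (Real.exp_pos _)]
          linarith [Real.add_one_le_exp (V / 10 * θ ^ 2)]
        calc _ = 60 * (|θ| * Real.exp (-(V / 10) * θ ^ 2)) *
              (V / 10 * θ ^ 2 * Real.exp (-(V / 10 * θ ^ 2))) := by
                rw [e1, ← sq_abs θ]; ring
          _ ≤ _ := mul_le_of_le_one_right (by positivity) e2
      rw [hsplit]
      refine (norm_add_le _ _).trans ((add_le_add ?_ t2).trans (b := 60 *
        (|θ| * Real.exp (-(V / 10) * θ ^ 2)) + Real.exp (-(V / 10) * θ ^ 2) * (|y| * |θ|))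
        (le_of_eq (by ring)))
      rw [norm_mul, norm_exp_ofReal_mul_I, mul_one]
      exact h2.trans t1
    · rw [Set.indicator_of_notMem h, zero_sub, norm_neg, hg, norm_real,
        Real.norm_of_nonneg (Real.exp_pos _).le]
      have hθ : 1 ≤ |θ| := by
        by_contra! hlt
        have := abs_lt.mp hlt
        exact h ⟨by linarith [Real.pi_gt_three], by linarith [Real.pi_gt_three]⟩
      calc _ ≤ Real.exp (-(V / 10) * θ ^ 2) := hle
        _ ≤ ((60 + |y|) * |θ|) * Real.exp (-(V / 10) * θ ^ 2) :=
            le_mul_of_one_le_left (Real.exp_pos _).le (by nlinarith [abs_nonneg y])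
        _ = _ := by ring
  have hmain : ‖(2 * Real.pi * w k : ℂ) - (√(Real.pi / (V / 2)) : ℝ)‖ ≤
      (60 + |y|) * (1 / (V / 10)) := by
    rw [← hint, ← hgval, ← integral_sub hψint hgint,
      ← integral_abs_mul_exp_neg_mul_sq (by positivity : 0 < V / 10), ← integral_const_mul]
    exact norm_integral_le_of_norm_le
      ((integrable_abs_mul_exp_neg_mul_sq (by positivity)).const_mul _) (.of_forall hbound)
  have hnorm : ‖(2 * Real.pi * w k : ℂ) - (√(Real.pi / (V / 2)) : ℝ)‖ =
      2 * Real.pi * |w k - 1 / √(2 * Real.pi * V)| := by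
    have hsq : √(Real.pi / (V / 2)) = 2 * Real.pi * (1 / √(2 * Real.pi * V)) := by
      have hpos : 0 < √(2 * Real.pi * V) := Real.sqrt_pos.mpr (by positivity)
      rw [Real.sqrt_eq_iff_mul_self_eq (by positivity) (by positivity)]
      field_simp
      exact Real.sq_sqrt (by positivity)
    have hreal : (2 * Real.pi * w k : ℂ) - (2 * Real.pi * (1 / √(2 * Real.pi * V)) : ℝ) =
        (2 * Real.pi * (w k - 1 / √(2 * Real.pi * V)) : ℝ) := by push_cast; ring
    rw [hsq, hreal, norm_real, Real.norm_eq_abs, abs_mul,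
      abs_of_pos (by positivity : 0 < 2 * Real.pi)]
  rw [hnorm] at hmain
  rw [le_div_iff₀ hV]
  have h6 : 6 * (|w k - 1 / √(2 * Real.pi * V)| * V) ≤ 10 * (60 + |y|) := by
    have hcancel : (60 + |y|) * (1 / (V / 10)) * V = 10 * (60 + |y|) := by field_simp
    calc _ ≤ 2 * Real.pi * (|w k - 1 / √(2 * Real.pi * V)| * V) :=
          mul_le_mul_of_nonneg_right (by linarith [Real.pi_gt_three]) (by positivity)
      _ ≤ (60 + |y|) * (1 / (V / 10)) * V := by
          rw [← mul_assoc]; exact mul_le_mul_of_nonneg_right hmain hV.le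
      _ = _ := hcancel
  linarith [abs_nonneg y]

end LocalLimit

section TailSum

theorem hasSum_int_add_nat {f : ℤ → ℝ} {S : Finset ℤ} (hf : ∀ k ∉ S, f k = 0) (c : ℤ) :
    HasSum (fun j : ℕ => f (c + j)) (∑ k ∈ S with c ≤ k, f k) := by
  have hinj : Function.Injective fun j : ℕ => c + (j : ℤ) := fun i j h => by
    simpa using h
  have h : HasSum (fun k : ℤ => if c ≤ k then f k else 0) (∑ k ∈ S with c ≤ k, f k) := by
    rw [sum_filter]
    exact hasSum_sum_of_ne_finset_zero fun k hk => by simp [hf k hk]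
  rw [← hinj.hasSum_iff fun k hk => ?_] at h
  · simpa [Function.comp_def] using h
  · refine if_neg fun hck => hk ⟨(k - c).toNat, ?_⟩
    simp only
    omega

theorem abs_geometric_tail_sub_le {u : ℕ → ℝ} {g E B τ δ R : ℝ} (hg : 0 ≤ g) (hE : 0 ≤ E)
    (hB : 0 ≤ B) (hu : ∀ j, |u j - g| ≤ E * (B + j)) (hτ : 0 < τ) (hτ1 : τ < 1)
    (hδ : 0 ≤ δ) (hδ1 : δ ≤ 1)
    (hR : HasSum (fun j : ℕ => u j * Real.exp (-τ * (j + δ))) R) :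
    |τ * R - g| ≤ g * τ + E * (2 * B + 4 / τ) := by
  set r := Real.exp (-τ) with hr
  have hr0 : 0 < r := Real.exp_pos _
  have hr1 : r < 1 := by rw [hr, ← Real.exp_zero]; exact Real.exp_lt_exp.mpr (by linarith)
  have hrinv : 1 + τ ≤ r⁻¹ := by
    rw [hr, ← Real.exp_neg, neg_neg]; linarith [Real.add_one_le_exp τ]
  have hrle : r * (1 + τ) ≤ 1 := by
    calc r * (1 + τ) ≤ r * r⁻¹ := mul_le_mul_of_nonneg_left hrinv hr0.le
      _ = 1 := mul_inv_cancel₀ hr0.ne'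
  have hrge : 1 - τ ≤ r := by linarith [Real.add_one_le_exp (-τ)]
  have hgeom : (1 - r)⁻¹ ≤ (1 + τ) / τ := by
    rw [inv_le_comm₀ (by linarith) (by positivity), inv_div, div_le_iff₀ (by linarith)]
    nlinarith
  have hgeom2 : (1 - r)⁻¹ ≤ 2 / τ :=
    hgeom.trans (div_le_div_of_nonneg_right (by linarith) hτ.le)
  have hexp : ∀ j : ℕ, Real.exp (-τ * (j + δ)) = Real.exp (-τ * δ) * r ^ j := fun j => by
    rw [hr, ← Real.exp_nat_mul, ← Real.exp_add]; congr 1; ring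
  have hd1 : Real.exp (-τ * δ) ≤ 1 := Real.exp_le_one_iff.mpr (by nlinarith)
  have hdr : r ≤ Real.exp (-τ * δ) := Real.exp_le_exp.mpr (by nlinarith)
  have hs0 := hasSum_geometric_of_lt_one hr0.le hr1
  have hs1 := hasSum_coe_mul_geometric_of_norm_lt_one (𝕜 := ℝ) (r := r)
    (by rwa [Real.norm_of_nonneg hr0.le])
  have hdiff : HasSum (fun j : ℕ => (u j - g) * Real.exp (-τ * (j + δ)))
      (R - g * (Real.exp (-τ * δ) * (1 - r)⁻¹)) := by
    have hj : ∀ j : ℕ, (u j - g) * Real.exp (-τ * (j + δ)) =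
        u j * Real.exp (-τ * (j + δ)) - g * (Real.exp (-τ * δ) * r ^ j) := fun j => by
      rw [hexp]; ring
    simp only [hj]
    exact hR.sub ((hs0.mul_left (Real.exp (-τ * δ))).mul_left g)
  have hmaj : HasSum (fun j : ℕ => E * (B * r ^ j + j * r ^ j))
      (E * (B * (1 - r)⁻¹ + r / (1 - r) ^ 2)) :=
    ((hs0.mul_left B).add hs1).mul_left E
  have hdev : |R - g * (Real.exp (-τ * δ) * (1 - r)⁻¹)| ≤
      E * (B * (1 - r)⁻¹ + r / (1 - r) ^ 2) := by
    rw [← Real.norm_eq_abs]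
    refine hdiff.norm_le_of_bounded hmaj fun j => ?_
    rw [Real.norm_eq_abs, abs_mul, abs_of_pos (Real.exp_pos _), hexp]
    calc |u j - g| * (Real.exp (-τ * δ) * r ^ j) ≤ (E * (B + j)) * (1 * r ^ j) :=
          mul_le_mul (hu j) (mul_le_mul_of_nonneg_right hd1 (by positivity)) (by positivity)
            (by positivity)
      _ = _ := by ring
  have hmajle : E * (B * (1 - r)⁻¹ + r / (1 - r) ^ 2) ≤ E * (B * (2 / τ) + (2 / τ) ^ 2) := by
    refine mul_le_mul_of_nonneg_left (add_le_add (mul_le_mul_of_nonneg_left hgeom2 hB) ?_) hE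
    calc r / (1 - r) ^ 2 ≤ 1 / (1 - r) ^ 2 := div_le_div_of_nonneg_right hr1.le (by positivity)
      _ = (1 - r)⁻¹ ^ 2 := by rw [inv_pow, one_div]
      _ ≤ _ := pow_le_pow_left₀ (inv_nonneg.mpr (by linarith)) hgeom2 2
  have hlead : |τ * (Real.exp (-τ * δ) * (1 - r)⁻¹) - 1| ≤ τ := by
    rw [← div_eq_mul_inv, abs_le]
    constructor
    · have : 1 - τ ≤ τ * (Real.exp (-τ * δ) / (1 - r)) := by
        rw [← mul_div_assoc, le_div_iff₀ (by linarith)]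
        nlinarith
      linarith
    · have : τ * (Real.exp (-τ * δ) / (1 - r)) ≤ 1 + τ := by
        rw [← mul_div_assoc, div_le_iff₀ (by linarith)]
        nlinarith
      linarith
  calc |τ * R - g| = |g * (τ * (Real.exp (-τ * δ) * (1 - r)⁻¹) - 1)
        + τ * (R - g * (Real.exp (-τ * δ) * (1 - r)⁻¹))| := by congr 1; ring
    _ ≤ g * τ + τ * (E * (B * (2 / τ) + (2 / τ) ^ 2)) := by
        refine (abs_add_le _ _).trans (add_le_add ?_ ?_)
        · rw [abs_mul, abs_of_nonneg hg]
          exact mul_le_mul_of_nonneg_left hlead hg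
        · rw [abs_mul, abs_of_pos hτ]
          exact mul_le_mul_of_nonneg_left (hdev.trans hmajle) hτ.le
    _ = _ := by field_simp; ring

theorem abs_upper_tail_sum_sub_le {S : Finset ℤ} {w : ℤ → ℝ} (hw : ∀ k ∉ S, w k = 0)
    {g E m : ℝ} (hg : 0 ≤ g) (hE : 0 ≤ E) (hwg : ∀ k : ℤ, |w k - g| ≤ E * (1 + |k - m|))
    {τ : ℝ} (hτ : 0 < τ) (hτ1 : τ < 1) (a : ℝ) :
    |τ * (∑ k ∈ S.filter (fun k : ℤ => a ≤ (k : ℝ)), w k * Real.exp (-τ * (k - a))) - g| ≤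
      g * τ + E * (2 * (2 + |a - m|) + 4 / τ) := by
  have h := hasSum_int_add_nat (f := fun k => w k * Real.exp (-τ * (k - a))) (S := S)
    (fun k hk => by simp [hw k hk]) ⌈a⌉
  simp only [Int.ceil_le] at h
  have hδ := Int.le_ceil a
  have hδ1 := Int.ceil_lt_add_one a
  refine abs_geometric_tail_sub_le (u := fun j => w (⌈a⌉ + j)) (δ := ⌈a⌉ - a) hg hE
    (by positivity) (fun j => ?_) hτ hτ1 (by linarith) (by linarith) ?_
  · refine (hwg _).trans (mul_le_mul_of_nonneg_left ?_ hE)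
    have : |((⌈a⌉ + j : ℤ) : ℝ) - m| ≤ |a - m| + |(⌈a⌉ - a + j : ℝ)| := by
      refine le_trans (le_of_eq ?_) (abs_add_le _ _)
      congr 1; push_cast; ring
    rw [abs_of_nonneg (by have := j.cast_nonneg (α := ℝ); linarith : 0 ≤ (⌈a⌉ - a + j : ℝ))] at this
    linarith
  · convert h using 4 with j
    push_cast; ring

theorem abs_lower_tail_sum_sub_le {S : Finset ℤ} {w : ℤ → ℝ} (hw : ∀ k ∉ S, w k = 0)
    {g E m : ℝ} (hg : 0 ≤ g) (hE : 0 ≤ E) (hwg : ∀ k : ℤ, |w k - g| ≤ E * (1 + |k - m|))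
    {τ : ℝ} (hτ : 0 < τ) (hτ1 : τ < 1) (a : ℝ) :
    |τ * (∑ k ∈ S.filter (fun k : ℤ => (k : ℝ) ≤ a), w k * Real.exp (-τ * (a - k))) - g| ≤
      g * τ + E * (2 * (2 + |a - m|) + 4 / τ) := by
  have h := abs_upper_tail_sum_sub_le (S := S.map (Equiv.neg ℤ).toEmbedding)
    (w := fun k => w (-k)) (m := -m) (fun k hk => hw _ fun hk' => hk (by simpa using hk'))
    hg hE (fun k => (hwg (-k)).trans_eq (by
      rw [← abs_neg]; push_cast; congr 3; ring)) hτ hτ1 (-a)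
  have hfilter : (S.filter ((fun k : ℤ => -a ≤ (k : ℝ)) ∘ (Equiv.neg ℤ).toEmbedding)) =
      S.filter (fun k : ℤ => (k : ℝ) ≤ a) := filter_congr fun k _ => by simp
  have hterm : ∀ k : ℤ, w (-(Equiv.neg ℤ).toEmbedding k) *
      Real.exp (-τ * ((((Equiv.neg ℤ).toEmbedding k : ℤ) : ℝ) - -a)) =
      w k * Real.exp (-τ * (a - k)) := fun k => by
    simp only [Equiv.coe_toEmbedding, Equiv.neg_apply, neg_neg, Int.cast_neg]
    congr 3; ring
  have hdist : |(-a - -m)| = |a - m| := by rw [← abs_neg]; congr 1; ring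
  rwa [filter_map, sum_map, hfilter, hdist, sum_congr rfl fun k _ => hterm k] at h

end TailSum

section TailEstimate

theorem abs_tail_sum_sub_le {S : Finset ℤ} {w : ℤ → ℝ} (hw : ∀ k ∉ S, w k = 0)
    {g E m : ℝ} (hg : 0 ≤ g) (hE : 0 ≤ E) (hwg : ∀ k : ℤ, |w k - g| ≤ E * (1 + |k - m|))
    {s : ℝ} (hs0 : s ≠ 0) (hs1 : |s| < 1) (a : ℝ) :
    |(|s| * ∑ k ∈ S.filter (fun k : ℤ => 0 ≤ s * (k - a)), w k * Real.exp (-s * (k - a))) - g| ≤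
      g * |s| + E * (2 * (2 + |a - m|) + 4 / |s|) := by
  rcases lt_or_gt_of_ne hs0 with h | h
  · have key := abs_lower_tail_sum_sub_le hw hg hE hwg (abs_pos.mpr hs0) hs1 a
    have hfilter : S.filter (fun k : ℤ => (k : ℝ) ≤ a) =
        S.filter (fun k : ℤ => 0 ≤ s * (k - a)) := filter_congr fun k _ => by
      rw [← neg_mul_neg, mul_nonneg_iff_of_pos_left (neg_pos.mpr h), neg_sub, sub_nonneg]
    have hterm : ∀ k : ℤ, w k * Real.exp (-|s| * (a - k)) = w k * Real.exp (-s * (k - a)) :=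
      fun k => by rw [abs_of_neg h]; congr 2; ring
    rwa [hfilter, sum_congr rfl fun k _ => hterm k] at key
  · have key := abs_upper_tail_sum_sub_le hw hg hE hwg (abs_pos.mpr hs0) hs1 a
    have hfilter : S.filter (fun k : ℤ => a ≤ (k : ℝ)) =
        S.filter (fun k : ℤ => 0 ≤ s * (k - a)) := filter_congr fun k _ => by
      rw [mul_nonneg_iff_of_pos_left h, sub_nonneg]
    have hterm : ∀ k : ℤ, w k * Real.exp (-|s| * (k - a)) = w k * Real.exp (-s * (k - a)) :=
      fun k => by rw [abs_of_pos h]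
    rwa [hfilter, sum_congr rfl fun k _ => hterm k] at key

theorem sum_tilted_mul_cexp {N : ℕ} {c : ℕ → ℝ} {ι : Type*} [Fintype ι] {q : ι → ℝ}
    (hq : ∀ j, 0 ≤ q j ∧ q j ≤ 1)
    (hc : ∀ z : ℂ, ∑ k ∈ range N, (c k : ℂ) * z ^ k = ∏ j, (1 - (q j : ℂ) + q j * z)) (s θ : ℝ) :
    ∑ l ∈ ((range N).map Nat.castEmbedding : Finset ℤ),
        ((c l.toNat * Real.exp (s * l) / ∏ j, (1 - q j + q j * Real.exp s) : ℝ) : ℂ) *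
          Complex.exp ((l : ℂ) * θ * Complex.I) =
      ∏ j, (1 - (tilt (q j) s : ℂ) + tilt (q j) s * Complex.exp (θ * Complex.I)) := by
  have hfac : ∀ j, 1 - (tilt (q j) s : ℂ) + tilt (q j) s * Complex.exp (θ * Complex.I) =
      (1 - (q j : ℂ) + q j * (Real.exp s * Complex.exp (θ * Complex.I))) /
        ((1 - q j + q j * Real.exp s : ℝ) : ℂ) := fun j => by
    have : ((1 - q j + q j * Real.exp s : ℝ) : ℂ) ≠ 0 :=
      Complex.ofReal_ne_zero.mpr (tilt_denom_pos (hq j) s).ne'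
    rw [eq_div_iff this, tilt, Complex.ofReal_div, add_mul, sub_mul, one_mul, mul_right_comm,
      div_mul_cancel₀ _ this]
    push_cast
    ring
  simp only [hfac]
  rw [prod_div_distrib, ← hc, sum_map, sum_div]
  refine sum_congr rfl fun k _ => ?_
  have hexp : Complex.exp ((k : ℂ) * θ * Complex.I) = Complex.exp (θ * Complex.I) ^ k := by
    rw [← Complex.exp_nat_mul, mul_assoc]
  have hexp2 : Real.exp (s * k) = Real.exp s ^ k := by rw [← Real.exp_nat_mul, mul_comm]
  simp only [Nat.castEmbedding_apply, Int.toNat_natCast, Int.cast_natCast]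
  rw [hexp, hexp2, mul_pow]
  push_cast
  ring

theorem abs_normalized_tail_sub_one_le {S V g R τ d : ℝ} (hS : 0 < S) (hτ : 0 < τ)
    (hτ6 : τ ≤ 1 / 6) (hV : |V - S| ≤ 3 * S * τ) (hd0 : 0 ≤ d) (hd : d ≤ 3 * S * τ ^ 2)
    (hg : g = 1 / √(2 * Real.pi * V))
    (hR : |τ * R - g| ≤ g * τ + 100 / V * (2 * (2 + d) + 4 / τ)) :
    |R * (τ * √(2 * Real.pi * S)) - 1| ≤
      8 * τ + 4800 * (1 / (√S * τ)) + 3600 * (√S * τ ^ 2) := by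
  have hVS : S / 2 ≤ V := by nlinarith [(abs_le.mp hV).1]
  have hVpos : 0 < V := by linarith
  set ρ := √(S / V) with hρ
  have hρ0 : 0 ≤ ρ := Real.sqrt_nonneg _
  have hρsq : ρ ^ 2 = S / V := Real.sq_sqrt (by positivity)
  have hgρ : √(2 * Real.pi * S) * g = ρ := by
    rw [hg, mul_one_div, ← Real.sqrt_div (by positivity), hρ]
    congr 1
    field_simp
  have hinv : 1 / V ≤ 2 / S := by
    rw [div_le_div_iff₀ hVpos hS]; linarith
  have hρ2 : ρ ≤ 2 := by
    have : S / V ≤ 2 := by rw [div_le_iff₀ hVpos]; linarith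
    nlinarith
  have hρ1 : |ρ - 1| ≤ 6 * τ := by
    have h1 : |ρ - 1| * (ρ + 1) = |S - V| / V := by
      rw [← abs_of_pos (by linarith : 0 < ρ + 1), ← abs_mul, ← abs_of_pos hVpos, ← abs_div,
        abs_of_pos hVpos, sub_div, div_self hVpos.ne', ← hρsq]
      congr 1; ring
    have h2 : |S - V| / V ≤ 6 * τ := by
      rw [abs_sub_comm, div_le_iff₀ hVpos]
      nlinarith
    nlinarith [abs_nonneg (ρ - 1)]
  have hb : √(2 * Real.pi * S) ≤ 3 * √S := by
    rw [Real.sqrt_le_left (by positivity), mul_pow, Real.sq_sqrt hS.le]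
    nlinarith [Real.pi_lt_four]
  have hσ : 0 < √S := Real.sqrt_pos.mpr hS
  calc |R * (τ * √(2 * Real.pi * S)) - 1| =
        |√(2 * Real.pi * S) * (τ * R - g) + (ρ - 1)| := by rw [← hgρ]; congr 1; ring
    _ ≤ √(2 * Real.pi * S) * (g * τ + 100 / V * (2 * (2 + d) + 4 / τ)) + 6 * τ := by
        refine (abs_add_le _ _).trans (add_le_add ?_ hρ1)
        rw [abs_mul, abs_of_nonneg (Real.sqrt_nonneg _)]
        exact mul_le_mul_of_nonneg_left hR (Real.sqrt_nonneg _)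
    _ = ρ * τ + √(2 * Real.pi * S) * (100 * (1 / V) * (2 * (2 + d) + 4 / τ)) + 6 * τ := by
        rw [← hgρ]; ring
    _ ≤ 2 * τ + 3 * √S * (100 * (2 / S) * (2 * (2 / τ + 3 * S * τ ^ 2) + 4 / τ)) + 6 * τ := by
        have h2 : 2 ≤ 2 / τ := by rw [le_div_iff₀ hτ]; linarith
        gcongr
    _ = _ := by
        have hSσ : S = √S ^ 2 := (Real.sq_sqrt hS.le).symm
        generalize √S = r at *
        rw [hSσ]
        field_simp
        ring

theorem exists_tail_estimate {n : ℕ} (hn : n ≠ 0) (hσ : 0 < σsq n) {s : ℝ} (hs0 : s ≠ 0)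
    (hs : |s| ≤ 1 / 6) :
    ∃ E : ℝ, |E| ≤ 3 * σsq n * |s| ^ 4 ∧
      |(∑ k ∈ (Icc 1 n).filter (fun k : ℕ => 0 ≤ s * (k - (μ n + s * σsq n))), p n k) *
          Real.exp (σsq n * s ^ 2 / 2
            - (∑ k ∈ Icc 1 n, ((k : ℝ) - μ n) ^ 3 * p n k) * s ^ 3 / 6 - E) *
          (|s| * √(2 * Real.pi * σsq n)) - 1| ≤
        8 * |s| + 4800 * (1 / (√(σsq n) * |s|)) + 3600 * (√(σsq n) * |s| ^ 2) := by
  obtain ⟨m, q, hq, hpoly, hμ, hvar, hthird⟩ := exists_bernoulli_representation hn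
  have hs1 : |s| ≤ 1 := hs.trans (by norm_num)
  have hτ : 0 < |s| := abs_pos.mpr hs0
  set a := μ n + s * σsq n with ha
  set P := ∏ j, (1 - q j + q j * Real.exp s) with hP
  have hPpos : 0 < P := prod_pos fun j _ => tilt_denom_pos (hq j) s
  have hlogP : Real.log P = ∑ j, Real.log (1 - q j + q j * Real.exp s) :=
    Real.log_prod fun j _ => (tilt_denom_pos (hq j) s).ne'
  set κ := ∑ k ∈ Icc 1 n, ((k : ℝ) - μ n) ^ 3 * p n k with hκ
  refine ⟨Real.log P - μ n * s - σsq n * s ^ 2 / 2 - κ * s ^ 3 / 6, ?_, ?_⟩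
  · rw [hlogP, hμ, hvar, hthird]
    simp only [sum_mul, sum_div, ← sum_sub_distrib, mul_sum]
    refine (abs_sum_le_sum_abs _ _).trans (sum_le_sum fun j _ => ?_)
    exact abs_log_tilt_sub_le (hq j) hs1
  set V := ∑ j, tilt (q j) s * (1 - tilt (q j) s) with hVdef
  have hV : |V - σsq n| ≤ 3 * σsq n * |s| := by
    rw [hvar, hVdef, ← sum_sub_distrib]
    simp only [sum_mul, mul_sum]
    refine (abs_sum_le_sum_abs _ _).trans (sum_le_sum fun j _ => ?_)
    exact abs_tilt_variance_sub_le (hq j) hs1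
  have hmean : |a - ∑ j, tilt (q j) s| ≤ 3 * σsq n * |s| ^ 2 := by
    have : a - ∑ j, tilt (q j) s = -∑ j, (tilt (q j) s - q j - q j * (1 - q j) * s) := by
      rw [ha, hμ, hvar]
      simp only [sum_sub_distrib, ← sum_mul]
      ring
    rw [this, abs_neg, hvar]
    simp only [sum_mul, mul_sum]
    refine (abs_sum_le_sum_abs _ _).trans (sum_le_sum fun j _ => ?_)
    exact abs_tilt_sub_le (hq j) hs1
  have hVpos : 0 < V := by
    have := (abs_le.mp hV).1
    nlinarith
  set w : ℤ → ℝ := fun l => p n l.toNat * Real.exp (s * l) / P with hw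
  set S : Finset ℤ := (range (n + 1)).map Nat.castEmbedding with hS
  have hwS : ∀ l ∉ S, w l = 0 := fun l hl => by
    have hp : p n l.toNat = 0 := by
      by_cases h : n < l.toNat
      · exact p_eq_zero_of_lt h
      · have h0 : l.toNat = 0 := by
          by_contra h0
          refine hl (mem_map.mpr ⟨l.toNat, mem_range.mpr (by omega), ?_⟩)
          simp only [Nat.castEmbedding_apply]
          omega
        rw [h0, p_zero_right, if_neg hn]
    simp [hw, hp]
  have hloc := abs_coeff_sub_gaussian_le (fun j => tilt_mem (hq j) s) hwS
    (fun θ => sum_tilted_mul_cexp hq hpoly s θ) hVpos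
  have htail := abs_tail_sum_sub_le hwS (by positivity)
    (by positivity : 0 ≤ 100 / V) (fun k => (hloc k).trans_eq (by ring)) hs0
    (hs.trans_lt (by norm_num)) a
  set R := ∑ k ∈ S.filter (fun k : ℤ => 0 ≤ s * (k - a)), w k * Real.exp (-s * (k - a)) with hR
  have hT : ∑ k ∈ (Icc 1 n).filter (fun k : ℕ => 0 ≤ s * (k - a)), p n k =
      P * Real.exp (-(s * a)) * R := by
    have h1 := sum_Icc_mul_p hn fun k => if 0 ≤ s * ((k : ℝ) - a) then 1 else 0
    simp only [ite_mul, one_mul, zero_mul, ← sum_filter] at h1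
    rw [h1, hR, hS, filter_map, sum_map, mul_sum]
    refine sum_congr (filter_congr fun k _ => by simp) fun k _ => ?_
    simp only [hw, Nat.castEmbedding_apply, Int.toNat_natCast, Int.cast_natCast]
    have he : Real.exp (-s * (k - a)) = Real.exp (s * a) * (Real.exp (s * k))⁻¹ := by
      rw [← Real.exp_neg, ← Real.exp_add]; congr 1; ring
    rw [he, Real.exp_neg]
    field_simp
  have hnorm : P * Real.exp (-(s * a)) * R * Real.exp (σsq n * s ^ 2 / 2 - κ * s ^ 3 / 6 -
      (Real.log P - μ n * s - σsq n * s ^ 2 / 2 - κ * s ^ 3 / 6)) = R := by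
    have : P * Real.exp (-(s * a)) * Real.exp (σsq n * s ^ 2 / 2 - κ * s ^ 3 / 6 -
      (Real.log P - μ n * s - σsq n * s ^ 2 / 2 - κ * s ^ 3 / 6)) = 1 := by
      rw [← Real.exp_log hPpos, ← Real.exp_add, ← Real.exp_add, Real.exp_eq_one_iff,
        Real.log_exp, ha]
      ring
    rw [mul_right_comm, this, one_mul]
  rw [hT, hnorm]
  exact abs_normalized_tail_sub_one_le hσ hτ hs hV (abs_nonneg _) hmean rfl htail

end TailEstimate

section Main

open Filter Topology

theorem tendsto_L : Tendsto L atTop atTop := by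
  refine (tendsto_rpow_atTop (by norm_num : (0 : ℝ) < 1 / 3)).comp ?_
  refine tendsto_atTop_mono' _ ?_ (tendsto_σsq.atTop_div_const (by norm_num : (0 : ℝ) < 18))
  exact eventually_third_central_moment_bounds.mono fun n h => h.1

theorem eventually_L_pow_three : ∀ᶠ n in atTop, 0 < L n ∧
    L n ^ 3 = ∑ k ∈ Icc 1 n, ((k : ℝ) - μ n) ^ 3 * p n k := by
  filter_upwards [eventually_third_central_moment_bounds, tendsto_σsq.eventually_gt_atTop 0,
    tendsto_L.eventually_gt_atTop 0] with n h hσ hL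
  refine ⟨hL, ?_⟩
  rw [L, ← Real.rpow_natCast, ← Real.rpow_mul (by linarith [h.1])]
  norm_num

theorem tendsto_normalized_tail {x : ℝ} (hx : 0 < x) {s : ℕ → ℝ}
    (hs : ∀ n, |s n| = x / |L n|) :
    Tendsto (fun n => (∑ k ∈ (Icc 1 n).filter
        (fun k : ℕ => 0 ≤ s n * (k - (μ n + s n * σsq n))), p n k) *
      Real.exp (σsq n * s n ^ 2 / 2 - L n ^ 3 * s n ^ 3 / 6) *
        (|s n| * √(2 * Real.pi * σsq n))) atTop (𝓝 1) := by
  have hτ : Tendsto (fun n => |s n|) atTop (𝓝 0) := by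
    simp only [hs]
    exact (tendsto_abs_atTop_atTop.comp tendsto_L).const_div_atTop x
  have hbounds : ∀ᶠ n in atTop, σsq n * |s n| ^ 4 ≤ 18 * x ^ 3 * |s n| ∧
      1 / (σsq n * |s n| ^ 2) ≤ 1 / x ^ 3 * |s n| := by
    filter_upwards [eventually_L_pow_three, eventually_third_central_moment_bounds,
      tendsto_σsq.eventually_gt_atTop 0] with n hL hκ hσ
    rw [← hL.2] at hκ
    have hL0 := hL.1
    rw [hs, abs_of_pos hL0]
    constructor
    · calc σsq n * (x / L n) ^ 4 ≤ 18 * L n ^ 3 * (x / L n) ^ 4 :=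
          mul_le_mul_of_nonneg_right (by linarith [hκ.1]) (by positivity)
        _ = _ := by field_simp
    · calc 1 / (σsq n * (x / L n) ^ 2) ≤ 1 / (L n ^ 3 * (x / L n) ^ 2) :=
          one_div_le_one_div_of_le (by positivity)
            (mul_le_mul_of_nonneg_right hκ.2 (by positivity))
        _ = _ := by field_simp
  have hquart : Tendsto (fun n => σsq n * |s n| ^ 4) atTop (𝓝 0) := by
    refine squeeze_zero' ?_ (hbounds.mono fun n h => h.1) (by simpa using hτ.const_mul (18 * x ^ 3))
    filter_upwards [tendsto_σsq.eventually_gt_atTop 0] with n hσ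
    positivity
  have hinv : Tendsto (fun n => 1 / (√(σsq n) * |s n|)) atTop (𝓝 0) := by
    have h : Tendsto (fun n => √(1 / (σsq n * |s n| ^ 2))) atTop (𝓝 0) := by
      have : Tendsto (fun n => 1 / (σsq n * |s n| ^ 2)) atTop (𝓝 0) := by
        refine squeeze_zero' ?_ (hbounds.mono fun n h => h.2)
          (by simpa only [mul_zero] using hτ.const_mul (1 / x ^ 3))
        filter_upwards [tendsto_σsq.eventually_gt_atTop 0] with n hσ
        positivity
      simpa using this.sqrt
    refine h.congr' ?_
    filter_upwards [tendsto_σsq.eventually_gt_atTop 0] with n hσ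
    rw [Real.sqrt_div zero_le_one, Real.sqrt_one, Real.sqrt_mul hσ.le, Real.sqrt_sq (abs_nonneg _)]
  have hsqrt : Tendsto (fun n => √(σsq n) * |s n| ^ 2) atTop (𝓝 0) := by
    have h : Tendsto (fun n => √(σsq n * |s n| ^ 4)) atTop (𝓝 0) := by simpa using hquart.sqrt
    refine h.congr' ?_
    filter_upwards [tendsto_σsq.eventually_gt_atTop 0] with n hσ
    rw [Real.sqrt_mul hσ.le, show |s n| ^ 4 = (|s n| ^ 2) ^ 2 by ring, Real.sqrt_sq (by positivity)]
  have hest : ∀ᶠ n in atTop, ∃ E : ℝ, |E| ≤ 3 * σsq n * |s n| ^ 4 ∧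
      |(∑ k ∈ (Icc 1 n).filter (fun k : ℕ => 0 ≤ s n * (k - (μ n + s n * σsq n))), p n k) *
          Real.exp (σsq n * s n ^ 2 / 2 - L n ^ 3 * s n ^ 3 / 6 - E) *
          (|s n| * √(2 * Real.pi * σsq n)) - 1| ≤
        8 * |s n| + 4800 * (1 / (√(σsq n) * |s n|)) + 3600 * (√(σsq n) * |s n| ^ 2) := by
    filter_upwards [eventually_L_pow_three, eventually_ne_atTop 0,
      tendsto_σsq.eventually_gt_atTop 0, hτ.eventually_le_const (by norm_num : (0 : ℝ) < 1 / 6)]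
      with n hL hn hσ hsn
    rw [hL.2]
    refine exists_tail_estimate hn hσ (abs_pos.mp ?_) hsn
    rw [hs, abs_of_pos hL.1]
    exact div_pos hx hL.1
  obtain ⟨E, hE⟩ := hest.choice
  have hE0 : Tendsto (fun n => Real.exp (E n)) atTop (𝓝 1) := by
    have : Tendsto E atTop (𝓝 0) := by
      refine squeeze_zero_norm' (hE.mono fun n h => h.1) ?_
      simpa [mul_assoc] using hquart.const_mul 3
    simpa using this.rexp
  have hmain : Tendsto (fun n =>
      (∑ k ∈ (Icc 1 n).filter (fun k : ℕ => 0 ≤ s n * (k - (μ n + s n * σsq n))), p n k) *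
          Real.exp (σsq n * s n ^ 2 / 2 - L n ^ 3 * s n ^ 3 / 6 - E n) *
          (|s n| * √(2 * Real.pi * σsq n))) atTop (𝓝 1) := by
    rw [tendsto_iff_norm_sub_tendsto_zero]
    refine squeeze_zero' (.of_forall fun n => norm_nonneg _) (hE.mono fun n h => h.2) ?_
    simpa using ((hτ.const_mul 8).add (hinv.const_mul 4800)).add (hsqrt.const_mul 3600)
  have hprod := hE0.mul hmain
  rw [one_mul] at hprod
  refine hprod.congr fun n => ?_
  have hexp : Real.exp (σsq n * s n ^ 2 / 2 - L n ^ 3 * s n ^ 3 / 6) =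
      Real.exp (E n) * Real.exp (σsq n * s n ^ 2 / 2 - L n ^ 3 * s n ^ 3 / 6 - E n) := by
    rw [← Real.exp_add]; congr 1; ring
  rw [hexp]
  ring

theorem sqrt_mul_mul_sqrt_eq {n : ℕ} (hL : 0 < L n) (hσ : 0 < σsq n) (x : ℝ) :
    √(σsq n / L n ^ 2) * x * √(σsq n) = x / L n * σsq n := by
  rw [Real.sqrt_div hσ.le, Real.sqrt_sq hL.le, mul_right_comm, div_mul_eq_mul_div,
    Real.mul_self_sqrt hσ.le]
  ring

theorem div_gaussian_eq {n : ℕ} (hL : 0 < L n) (hσ : 0 < σsq n) {x s T : ℝ}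
    (hs : |s| = x / L n) (hx : 0 < x) :
    T * Real.exp (σsq n * s ^ 2 / 2 - L n ^ 3 * s ^ 3 / 6) * (|s| * √(2 * Real.pi * σsq n)) =
      T / (Real.exp (-(σsq n / L n ^ 2) * x ^ 2 / 2) /
        (x * √(2 * Real.pi * (σsq n / L n ^ 2))) * Real.exp (L n ^ 3 * s ^ 3 / 6)) := by
  have h1 : √(2 * Real.pi * (σsq n / L n ^ 2)) = √(2 * Real.pi * σsq n) / L n := by
    rw [← mul_div_assoc, Real.sqrt_div (by positivity), Real.sqrt_sq hL.le]
  have h2 : s ^ 2 = (x / L n) ^ 2 := by rw [← hs, sq_abs]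
  have h3 : σsq n * s ^ 2 / 2 = -(-(σsq n / L n ^ 2) * x ^ 2 / 2) := by
    rw [h2]; field_simp
  rw [h1, hs, h3, Real.exp_sub, Real.exp_neg]
  field_simp

end Main

/-- Precise moderate deviations at the edge of the normality zone: for every `x > 0`,
with `t_n = σ_n²/L_n²`, as `n → ∞`,
`P((f_0(T_n) − μ_n)/σ_n ≥ √(t_n) x) = (e^{−t_n x²/2}/(x √(2π t_n))) e^{x³/6} (1+o(1))` and
`P((f_0(T_n) − μ_n)/σ_n ≤ −√(t_n) x) = (e^{−t_n x²/2}/(x √(2π t_n))) e^{−x³/6} (1+o(1))`. -/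
theorem precise_moderate_deviations (x : ℝ) (hx : 0 < x) :
    Filter.Tendsto
        (fun n : ℕ =>
          tailProb n (Real.sqrt (σsq n / L n ^ 2) * x) /
            (Real.exp (-(σsq n / L n ^ 2) * x ^ 2 / 2) /
                (x * Real.sqrt (2 * Real.pi * (σsq n / L n ^ 2))) *
              Real.exp (x ^ 3 / 6)))
        Filter.atTop (nhds 1) ∧
      Filter.Tendsto
        (fun n : ℕ =>
          lowerTailProb n (-(Real.sqrt (σsq n / L n ^ 2) * x)) /
            (Real.exp (-(σsq n / L n ^ 2) * x ^ 2 / 2) /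
                (x * Real.sqrt (2 * Real.pi * (σsq n / L n ^ 2))) *
              Real.exp (-(x ^ 3) / 6)))
        Filter.atTop (nhds 1) := by

  have hev := eventually_L_pow_three.and (tendsto_σsq.eventually_gt_atTop 0)
  constructor
  · refine (tendsto_normalized_tail hx (s := fun n => x / L n)
      fun n => by rw [abs_div, abs_of_pos hx]).congr' ?_
    filter_upwards [hev] with n ⟨⟨hL, _⟩, hσ⟩
    rw [div_gaussian_eq hL hσ (abs_of_pos (div_pos hx hL)) hx, tailProb,
      sqrt_mul_mul_sqrt_eq hL hσ]
    congr 1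
    · refine sum_congr (filter_congr fun k _ => ?_) fun _ _ => rfl
      rw [mul_nonneg_iff_of_pos_left (div_pos hx hL), sub_nonneg]
    · congr 3
      field_simp
  · refine (tendsto_normalized_tail hx (s := fun n => -(x / L n))
      fun n => by rw [abs_neg, abs_div, abs_of_pos hx]).congr' ?_
    filter_upwards [hev] with n ⟨⟨hL, _⟩, hσ⟩
    rw [div_gaussian_eq hL hσ (by rw [abs_neg, abs_of_pos (div_pos hx hL)]) hx, lowerTailProb,
      neg_mul (_ * x), sqrt_mul_mul_sqrt_eq hL hσ]
    congr 1
    · refine sum_congr (filter_congr fun k _ => ?_) fun _ _ => rfl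
      rw [neg_mul, ← mul_neg, mul_nonneg_iff_of_pos_left (div_pos hx hL), neg_sub, sub_nonneg,
        neg_mul]
    · congr 3
      field_simp
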